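/- arXiv:2501.01703 — 3 statements merged into one kernel-verified Lean document; each statement's English description precedes it below -/
import Mathlib

section
/- Let G be a graph, B a bramble in G of maximum order among all brambles in G, and X a subset of V(G). If the subfamily B_X of B consisting of those elements that intersect X has order at most k, then the treewidth of G is at most the treewidth of G - X plus k. -/
open SimpleGraph

variable {V : Type*}

/-- A bramble: a family of vertex sets, each inducing a connected subgraph,
pairwise intersecting or joined by an edge. -/
def IsBramble (G : SimpleGraph V) (B : Set (Set V)) : Prop :=
  (∀ S ∈ B, S.Nonempty ∧ (G.induce S).Connected) ∧
  (∀ S ∈ B, ∀ T ∈ B, (S ∩ T).Nonempty ∨ ∃ u ∈ S, ∃ v ∈ T, G.Adj u v)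

/-- `X` hits every element of the family `B`. -/
def HitsAll (B : Set (Set V)) (X : Set V) : Prop := ∀ S ∈ B, (S ∩ X).Nonempty

/-- The order of a bramble: minimum size of a hitting set. -/
noncomputable def brambleOrder (B : Set (Set V)) : ℕ :=
  sInf {n | ∃ X : Set V, X.Finite ∧ X.ncard = n ∧ HitsAll B X}

/-- The subfamily of elements of `B` meeting `X`. -/
def sub (B : Set (Set V)) (X : Set V) : Set (Set V) := {S ∈ B | (S ∩ X).Nonempty}

/-- `G` has a tree decomposition of width at most `w`. -/
def HasTreeDecompWidth (G : SimpleGraph V) (w : ℕ) : Prop :=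
  ∃ (ι : Type) (T : SimpleGraph ι) (bag : ι → Set V),
    T.IsTree ∧
    (∀ v, ∃ i, v ∈ bag i) ∧
    (∀ u v, G.Adj u v → ∃ i, u ∈ bag i ∧ v ∈ bag i) ∧
    (∀ v, (T.induce {i | v ∈ bag i}).Connected) ∧
    (∀ i, (bag i).Finite ∧ (bag i).ncard ≤ w + 1)

/-- The treewidth of `G`. -/
noncomputable def treewidth (G : SimpleGraph V) : ℕ := sInf {w | HasTreeDecompWidth G w}


lemma conn_closed {α : Type*} {G : SimpleGraph α} {S : Set α} (h : (G.induce S).Connected)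
    {D : Set α} {a : α} (haS : a ∈ S) (haD : a ∈ D)
    (hcl : ∀ u ∈ S, u ∈ D → ∀ w ∈ S, G.Adj u w → w ∈ D) : S ⊆ D := by
  intro v hv
  have hr := h.preconnected ⟨a, haS⟩ ⟨v, hv⟩
  rw [SimpleGraph.reachable_iff_reflTransGen] at hr
  have key : ∀ x : S, Relation.ReflTransGen (G.induce S).Adj ⟨a, haS⟩ x → (x : α) ∈ D := by
    intro x hx
    induction hx with
    | refl => exact haD
    | tail _ hbc ih => exact hcl _ (Subtype.prop _) ih _ (Subtype.prop _) (by simpa using hbc)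
  exact key _ hr

lemma conn_of_root {α : Type*} {G : SimpleGraph α} {S : Set α} {a : α} (haS : a ∈ S)
    (h : ∀ D : Set α, a ∈ D → (∀ u ∈ S, u ∈ D → ∀ w ∈ S, G.Adj u w → w ∈ D) → S ⊆ D) :
    (G.induce S).Connected := by
  have := h {v | ∃ hv : v ∈ S, (G.induce S).Reachable ⟨a, haS⟩ ⟨v, hv⟩}
    ⟨haS, SimpleGraph.Reachable.refl _⟩ (by
      rintro u hu ⟨_, hr⟩ w hw hadj
      refine ⟨hw, hr.trans (SimpleGraph.Adj.reachable ?_)⟩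
      simpa using hadj)
  rw [SimpleGraph.connected_iff_exists_forall_reachable]
  refine ⟨⟨a, haS⟩, fun w => ?_⟩
  obtain ⟨_, hr⟩ := this w.2
  exact hr

/-- `t` separates `s` from `r` (weakly). -/
def Anc {ι : Type*} (T : SimpleGraph ι) (s t r : ι) : Prop := ∀ p : T.Walk s r, t ∈ p.support

lemma anc_self {ι : Type*} (T : SimpleGraph ι) (s t : ι) : Anc T s t t := fun p => p.end_mem_support

lemma anc_root {ι : Type*} (T : SimpleGraph ι) (s r : ι) : Anc T s s r :=
  fun p => p.start_mem_support

lemma anc_eq_root {ι : Type*} {T : SimpleGraph ι} {s t : ι} (h : Anc T s t s) : t = s := by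
  simpa using h SimpleGraph.Walk.nil

lemma anc_adj {ι : Type*} {T : SimpleGraph ι} {s t r r' : ι} (h : Anc T s t r) (hadj : T.Adj r r')
    (hne : r ≠ t) : Anc T s t r' := by
  intro p
  have := h (p.concat hadj.symm)
  rw [SimpleGraph.Walk.support_concat] at this
  simp only [List.mem_append, List.mem_singleton] at this
  rcases this with h | h
  · exact h
  · exact absurd h.symm hne

/-- A connected set avoiding `t` containing a node below `t` is entirely below `t`. -/
lemma anc_conn {ι : Type*} {T : SimpleGraph ι} {s t r r' : ι} {S : Set ι}
    (hS : (T.induce S).Connected) (ht : t ∉ S) (hr : r ∈ S) (h : Anc T s t r) (hr' : r' ∈ S) :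
    Anc T s t r' := by
  have : S ⊆ {u | Anc T s t u} := conn_closed hS hr h (by
    intro u hu hD w _ hadj
    exact anc_adj hD hadj (fun e => ht (e ▸ hu)))
  exact this hr'

lemma anc_of_path {ι : Type*} {T : SimpleGraph ι} (hT : T.IsTree) {s t r : ι} {p : T.Walk s r}
    (hp : p.IsPath) (ht : t ∈ p.support) : Anc T s t r := by
  classical
  intro q
  have := (hT.isAcyclic.subsingleton_path _ _).elim ⟨p, hp⟩ q.toPath
  have h2 : p = q.toPath.1 := congrArg Subtype.val this
  rw [h2] at ht
  exact q.support_bypass_subset_support ht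

lemma anc_dist {ι : Type*} {T : SimpleGraph ι} (hT : T.IsTree) {s t r : ι}
    (h : Anc T s t r) : t = r ∨ T.dist s t < T.dist s r := by
  classical
  by_cases e : t = r
  · exact Or.inl e
  right
  obtain ⟨p, hp⟩ := (hT.connected).exists_walk_length_eq_dist s r
  have ht := h p
  have h1 := p.length_takeUntil_lt_length ht e
  have h2 := SimpleGraph.dist_le (p.takeUntil t ht)
  omega

lemma anc_of_adj_dist {ι : Type*} {T : SimpleGraph ι} (hT : T.IsTree) {s t r : ι}
    (hadj : T.Adj t r) (hd : T.dist s t ≤ T.dist s r) : Anc T s t r := by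
  classical
  obtain ⟨p, hp, hl⟩ := (hT.connected s t).exists_path_of_dist
  have hr : r ∉ p.support := by
    intro hr
    have h1 := p.length_takeUntil_lt_length hr hadj.ne'
    have h2 := SimpleGraph.dist_le (p.takeUntil r hr)
    omega
  exact anc_of_path hT (hp.concat hr hadj) (by
    rw [SimpleGraph.Walk.support_concat]; simp)

/-- A node closest to the root is an ancestor of everything in a connected set. -/
lemma anc_of_min {ι : Type*} {T : SimpleGraph ι} (hT : T.IsTree) {s t r : ι} {S : Set ι}
    (hS : (T.induce S).Connected) (ht : t ∈ S) (hmin : ∀ u ∈ S, T.dist s t ≤ T.dist s u)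
    (hr : r ∈ S) : Anc T s t r := by
  have : S ⊆ {u | Anc T s t u} := conn_closed hS ht (anc_self T s t) (by
    intro u hu hD w hw hadj
    by_cases e : u = t
    · subst e; exact anc_of_adj_dist hT hadj (hmin w hw)
    · exact anc_adj hD hadj e)
  exact this hr

/-- Helly property. -/
lemma helly {ι : Type*} {T : SimpleGraph ι} (hT : T.IsTree) {F : Set (Set ι)} (hF : F.Finite)
    (hconn : ∀ S ∈ F, (T.induce S).Connected) (hint : ∀ S ∈ F, ∀ S' ∈ F, (S ∩ S').Nonempty) :
    ∃ t, ∀ S ∈ F, t ∈ S := by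
  classical
  obtain ⟨s⟩ := hT.connected.nonempty
  rcases F.eq_empty_or_nonempty with rfl | hne
  · exact ⟨s, by simp⟩
  have hm : ∀ S : Set ι, S ∈ F → ∃ t ∈ S, ∀ u ∈ S, T.dist s t ≤ T.dist s u := by
    intro S hS
    obtain ⟨x, hx, _⟩ := hint S hS S hS
    exact exists_minimalFor_of_wellFoundedLT (· ∈ S) (T.dist s) ⟨x, hx⟩ |>.imp
      fun t ht => ⟨ht.1, fun u hu => by
        by_contra hc
        have := ht.2 hu (by omega)
        omega⟩
  have : Nonempty ι := ⟨s⟩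
  choose! m hm1 hm2 using hm
  obtain ⟨b, hb, hmax⟩ := Set.exists_max_image F (fun S => T.dist s (m S)) hF hne
  refine ⟨m b, fun S hS => ?_⟩
  by_contra hnot
  obtain ⟨r, hrS, hrb⟩ := hint S hS b hb
  have h1 : Anc T s (m b) r := anc_of_min hT (hconn b hb) (hm1 b hb) (hm2 b hb) hrb
  have h2 : Anc T s (m b) (m S) := anc_conn (hconn S hS) hnot hrS h1 (hm1 S hS)
  rcases anc_dist hT h2 with e | hlt
  · exact hnot (e ▸ hm1 S hS)
  · have := hmax S hS
    omega

lemma sum_acyclic {α β : Type*} {G : SimpleGraph α} {H : SimpleGraph β} (hG : G.IsAcyclic)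
    (hH : H.IsAcyclic) : (G ⊕g H).IsAcyclic := by
  rw [SimpleGraph.isAcyclic_iff_forall_adj_isBridge] at *
  rintro (u | u) (v | v) huv
  · have h := hG (SimpleGraph.sum_adj_inl.1 huv)
    rw [SimpleGraph.isBridge_iff] at h ⊢
    intro hr
    apply h
    rw [SimpleGraph.reachable_iff_reflTransGen] at hr
    have key : ∀ x : α ⊕ β, Relation.ReflTransGen ((G ⊕g H).deleteEdges {s(Sum.inl u, Sum.inl v)}).Adj
      (Sum.inl u) x → ∃ y, x = Sum.inl y ∧ (G.deleteEdges {s(u, v)}).Reachable u y := by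
      intro x hx
      induction hx with
      | refl => exact ⟨u, rfl, SimpleGraph.Reachable.refl _⟩
      | @tail b c _ hbc ih =>
        obtain ⟨y, rfl, hy⟩ := ih
        rcases c with c | c
        · refine ⟨c, rfl, hy.trans (SimpleGraph.Adj.reachable ?_)⟩
          simpa [SimpleGraph.deleteEdges_adj] using hbc
        · simp [SimpleGraph.deleteEdges_adj] at hbc
    obtain ⟨y, hy, h3⟩ := key _ hr
    cases hy
    exact h3
  · simp at huv
  · simp at huv
  · have h := hH (SimpleGraph.sum_adj_inr.1 huv)
    rw [SimpleGraph.isBridge_iff] at h ⊢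
    intro hr
    apply h
    rw [SimpleGraph.reachable_iff_reflTransGen] at hr
    have key : ∀ x : α ⊕ β, Relation.ReflTransGen ((G ⊕g H).deleteEdges {s(Sum.inr u, Sum.inr v)}).Adj
      (Sum.inr u) x → ∃ y, x = Sum.inr y ∧ (H.deleteEdges {s(u, v)}).Reachable u y := by
      intro x hx
      induction hx with
      | refl => exact ⟨u, rfl, SimpleGraph.Reachable.refl _⟩
      | @tail b c _ hbc ih =>
        obtain ⟨y, rfl, hy⟩ := ih
        rcases c with c | c
        · simp [SimpleGraph.deleteEdges_adj] at hbc
        · refine ⟨c, rfl, hy.trans (SimpleGraph.Adj.reachable ?_)⟩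
          simpa [SimpleGraph.deleteEdges_adj] using hbc
    obtain ⟨y, hy, h3⟩ := key _ hr
    cases hy
    exact h3

lemma tree_glue {α β : Type*} {G : SimpleGraph α} {H : SimpleGraph β} (hG : G.IsTree)
    (hH : H.IsTree) (a : α) (b : β) :
    ((G ⊕g H) ⊔ SimpleGraph.edge (Sum.inl a) (Sum.inr b)).IsTree :=
  ⟨hG.connected.sum_sup_edge hH.connected,
   (sum_acyclic hG.isAcyclic hH.isAcyclic).sup_edge_of_not_reachable
     (SimpleGraph.not_reachable_sum_inl_inr a b)⟩

/-- Tree decompositions of `G[U]`. -/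
structure TD {ι : Type} (G : SimpleGraph V) (U : Set V) (T : SimpleGraph ι) (bag : ι → Set V) :
    Prop where
  tree : T.IsTree
  sub : ∀ i, bag i ⊆ U
  edge : ∀ u ∈ U, ∀ v ∈ U, G.Adj u v → ∃ i, u ∈ bag i ∧ v ∈ bag i
  conn : ∀ v ∈ U, (T.induce {i | v ∈ bag i}).Connected

/-- nodes meeting a connected set form a connected set -/
lemma TD.conn_set {ι : Type} {G : SimpleGraph V} {U : Set V} {T : SimpleGraph ι}
    {bag : ι → Set V} (h : TD G U T bag) {b : Set V} (hb : (G.induce b).Connected)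
    (hbU : b ⊆ U) : (T.induce {i | (b ∩ bag i).Nonempty}).Connected := by
  obtain ⟨⟨v, hv⟩⟩ := hb.nonempty
  obtain ⟨⟨i, hi⟩⟩ := (h.conn v (hbU hv)).nonempty
  refine conn_of_root (a := i) ⟨v, hv, hi⟩ ?_
  intro D hiD hcl
  have step : ∀ x ∈ b, ∀ j ∈ D, x ∈ bag j → {i | x ∈ bag i} ⊆ D := by
    intro x hx j hj hxj
    refine conn_closed (h.conn x (hbU hx)) hxj hj ?_
    intro u hu huD w hw hadj
    exact hcl u ⟨x, hx, hu⟩ huD w ⟨x, hx, hw⟩ hadj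
  have : b ⊆ {x | {i | x ∈ bag i} ⊆ D} := by
    refine conn_closed hb hv (step v hv i hiD hi) ?_
    intro u hu huD w hw hadj
    obtain ⟨j, hj1, hj2⟩ := h.edge u (hbU hu) w (hbU hw) hadj
    exact step w hw j (huD hj1) hj2
  rintro j ⟨x, hx, hxj⟩
  exact this hx hxj

/-- Easy direction of the duality. -/
lemma TD.bag_hits [Finite V] {ι : Type} {G : SimpleGraph V} {T : SimpleGraph ι}
    {bag : ι → Set V} (h : TD G Set.univ T bag) {B : Set (Set V)} (hB : IsBramble G B) :
    ∃ t, HitsAll B (bag t) := by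
  obtain ⟨t, ht⟩ := helly h.tree (F := (fun b => {i | (b ∩ bag i).Nonempty}) '' B)
    (Set.Finite.image _ (Set.toFinite B)) (by
      rintro _ ⟨b, hb, rfl⟩
      exact h.conn_set (hB.1 b hb).2 (Set.subset_univ _)) (by
      rintro _ ⟨b, hb, rfl⟩ _ ⟨c, hc, rfl⟩
      rcases hB.2 b hb c hc with ⟨x, hx1, hx2⟩ | ⟨u, hu, v, hv, huv⟩
      · obtain ⟨⟨i, hi⟩⟩ := (h.conn x trivial).nonempty
        exact ⟨i, ⟨x, hx1, hi⟩, ⟨x, hx2, hi⟩⟩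
      · obtain ⟨i, hi1, hi2⟩ := h.edge u trivial v trivial huv
        exact ⟨i, ⟨u, hu, hi1⟩, ⟨v, hv, hi2⟩⟩)
  exact ⟨t, fun b hb => ht _ ⟨b, hb, rfl⟩⟩

/-- `G[U]` has an admissible tree decomposition with `R` as a bag. -/
def Adm (G : SimpleGraph V) (k : ℕ) (B : Set (Set V)) (U R : Set V) : Prop :=
  ∃ (ι : Type) (T : SimpleGraph ι) (bag : ι → Set V) (s : ι), TD G U T bag ∧ bag s = R ∧
    ∀ i, k < (bag i).ncard → ¬ HitsAll B (bag i)

lemma td_single (G : SimpleGraph V) (R : Set V) :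
    TD G R (⊥ : SimpleGraph Unit) (fun _ => R) where
  tree := SimpleGraph.IsTree.of_subsingleton
  sub _ := subset_rfl
  edge u hu v hv _ := ⟨(), hu, hv⟩
  conn v hv := conn_of_root (a := ()) hv (fun _ hD _ _ _ => hD)

lemma adm_single (G : SimpleGraph V) (k : ℕ) (B : Set (Set V)) (R : Set V)
    (h : k < R.ncard → ¬ HitsAll B R) : Adm G k B R R :=
  ⟨Unit, ⊥, fun _ => R, (), td_single G R, rfl, fun _ => h⟩

lemma adm_glue {G : SimpleGraph V} {k : ℕ} {B : Set (Set V)} {U R U' R' : Set V}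
    (h : Adm G k B U R) (h' : Adm G k B U' R') (hi : U ∩ U' ⊆ R ∩ R')
    (he : ∀ u ∈ U, ∀ v ∈ U', G.Adj u v → (u ∈ U' ∨ v ∈ U)) : Adm G k B (U ∪ U') R := by
  obtain ⟨ι, T, bag, s, td, hs, ha⟩ := h
  obtain ⟨ι', T', bag', s', td', hs', ha'⟩ := h'
  refine ⟨ι ⊕ ι', (T ⊕g T') ⊔ SimpleGraph.edge (Sum.inl s) (Sum.inr s'), Sum.elim bag bag',
    Sum.inl s, ⟨tree_glue td.tree td'.tree s s', ?_, ?_, ?_⟩, by simpa using hs, ?_⟩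
  · rintro (i | i)
    · exact (td.sub i).trans Set.subset_union_left
    · exact (td'.sub i).trans Set.subset_union_right
  · have e1 : ∀ u ∈ U, ∀ v ∈ U, G.Adj u v →
        ∃ i, u ∈ Sum.elim bag bag' i ∧ v ∈ Sum.elim bag bag' i := by
      intro u hu v hv huv
      obtain ⟨i, h1, h2⟩ := td.edge u hu v hv huv
      exact ⟨Sum.inl i, h1, h2⟩
    have e2 : ∀ u ∈ U', ∀ v ∈ U', G.Adj u v →
        ∃ i, u ∈ Sum.elim bag bag' i ∧ v ∈ Sum.elim bag bag' i := by
      intro u hu v hv huv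
      obtain ⟨i, h1, h2⟩ := td'.edge u hu v hv huv
      exact ⟨Sum.inr i, h1, h2⟩
    rintro u (hu | hu) v (hv | hv) huv
    · exact e1 u hu v hv huv
    · rcases he u hu v hv huv with h | h
      · exact e2 u h v hv huv
      · exact e1 u hu v h huv
    · rcases he v hv u hu huv.symm with h | h
      · exact e2 u hu v h huv
      · exact e1 u h v hv huv
    · exact e2 u hu v hv huv
  · intro v hv
    have c1 : ∀ D : Set (ι ⊕ ι'), (∀ u ∈ {i | v ∈ Sum.elim bag bag' i}, u ∈ D →
        ∀ w ∈ {i | v ∈ Sum.elim bag bag' i},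
        ((T ⊕g T') ⊔ SimpleGraph.edge (Sum.inl s) (Sum.inr s')).Adj u w → w ∈ D) → v ∈ U →
        ∀ i, v ∈ bag i → Sum.inl i ∈ D → ∀ j, v ∈ bag j → Sum.inl j ∈ D := by
      intro D hcl hvU i hi hiD j hj
      refine conn_closed (D := {i | Sum.inl i ∈ D}) (td.conn v hvU) hi hiD ?_ hj
      intro u hu huD w hw hadj
      exact hcl (Sum.inl u) hu huD (Sum.inl w) hw (Or.inl (SimpleGraph.sum_adj_inl.2 hadj))
    have c2 : ∀ D : Set (ι ⊕ ι'), (∀ u ∈ {i | v ∈ Sum.elim bag bag' i}, u ∈ D →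
        ∀ w ∈ {i | v ∈ Sum.elim bag bag' i},
        ((T ⊕g T') ⊔ SimpleGraph.edge (Sum.inl s) (Sum.inr s')).Adj u w → w ∈ D) → v ∈ U' →
        ∀ i, v ∈ bag' i → Sum.inr i ∈ D → ∀ j, v ∈ bag' j → Sum.inr j ∈ D := by
      intro D hcl hvU i hi hiD j hj
      refine conn_closed (D := {i | Sum.inr i ∈ D}) (td'.conn v hvU) hi hiD ?_ hj
      intro u hu huD w hw hadj
      exact hcl (Sum.inr u) hu huD (Sum.inr w) hw (Or.inl (SimpleGraph.sum_adj_inr.2 hadj))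
    by_cases h1 : v ∈ U
    · by_cases h2 : v ∈ U'
      · have hv2 := hi ⟨h1, h2⟩
        rw [← hs, ← hs'] at hv2
        refine conn_of_root (a := Sum.inl s) hv2.1 ?_
        rintro D hD hcl (j | j) hj
        · exact c1 D hcl h1 s hv2.1 hD j hj
        · refine c2 D hcl h2 s' hv2.2 ?_ j hj
          exact hcl (Sum.inl s) hv2.1 hD (Sum.inr s') hv2.2 (Or.inr (by
            simp [SimpleGraph.edge_adj]))
      · obtain ⟨⟨i, hi⟩⟩ := (td.conn v h1).nonempty
        refine conn_of_root (a := Sum.inl i) hi ?_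
        rintro D hD hcl (j | j) hj
        · exact c1 D hcl h1 i hi hD j hj
        · exact absurd (td'.sub j hj) h2
    · have h2 : v ∈ U' := hv.resolve_left h1
      obtain ⟨⟨i, hi⟩⟩ := (td'.conn v h2).nonempty
      refine conn_of_root (a := Sum.inr i) hi ?_
      rintro D hD hcl (j | j) hj
      · exact absurd (td.sub j hj) h1
      · exact c2 D hcl h2 i hi hD j hj
  · rintro (i | i)
    · exact ha i
    · exact ha' i

/-- The nodes of `T` containing `C` part and, for `X`, everything below. -/
def newBag {ι : Type} (T : SimpleGraph ι) (bag : ι → Set V) (s : ι) (X C : Set V) (t : ι) : Set V :=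
  (bag t ∩ C) ∪ (X ∩ {v | ∃ t', Anc T s t t' ∧ v ∈ bag t'})

lemma newBag_td {ι : Type} {G : SimpleGraph V} {T : SimpleGraph ι} {bag : ι → Set V}
    (td : TD G Set.univ T bag) (s : ι) {X C : Set V} (hXC : Disjoint X C) :
    TD G (X ∪ C) T (newBag T bag s X C) where
  tree := td.tree
  sub i := by
    rintro v (hv | hv)
    · exact Or.inr hv.2
    · exact Or.inl hv.1
  edge := by
    have key : ∀ v ∈ X ∪ C, ∀ i, v ∈ bag i → v ∈ newBag T bag s X C i := by
      rintro v (hv | hv) i hi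
      · exact Or.inr ⟨hv, i, anc_self _ _ _, hi⟩
      · exact Or.inl ⟨hi, hv⟩
    intro u hu v hv huv
    obtain ⟨i, h1, h2⟩ := td.edge u trivial v trivial huv
    exact ⟨i, key u hu i h1, key v hv i h2⟩
  conn := by
    rintro v (hv | hv)
    · have hvC : v ∉ C := Set.disjoint_left.1 hXC hv
      have hset : {i | v ∈ newBag T bag s X C i} = {i | ∃ t', Anc T s i t' ∧ v ∈ bag t'} := by
        ext i
        simp [newBag, hvC, hv]
      rw [hset]
      obtain ⟨⟨i, hi⟩⟩ := (td.conn v trivial).nonempty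
      refine conn_of_root (a := s) ⟨i, anc_root _ _ _, hi⟩ ?_
      rintro D hsD hcl t ⟨t', hanc, ht'⟩
      obtain ⟨p, hp, -⟩ := td.tree.existsUnique_path s t'
      have hall : ∀ u ∈ p.support, u ∈ {i | ∃ t', Anc T s i t' ∧ v ∈ bag t'} :=
        fun u hu => ⟨t', anc_of_path td.tree hp hu, ht'⟩
      have gen : ∀ (a b : ι) (q : T.Walk a b), a ∈ D →
          (∀ u ∈ q.support, u ∈ {i | ∃ t', Anc T s i t' ∧ v ∈ bag t'}) →
          ∀ u ∈ q.support, u ∈ D := by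
        intro a b q
        induction q with
        | nil => intro ha _ u hu; simp at hu; exact hu ▸ ha
        | @cons a c b hadj q ih =>
          intro ha hq u hu
          rw [SimpleGraph.Walk.support_cons, List.mem_cons] at hu
          rcases hu with rfl | hu
          · exact ha
          · refine ih ?_ (fun w hw => hq w ?_) u hu
            · refine hcl a (hq a ?_) ha c (hq c ?_) hadj
              · simp
              · simp
            · simp [hw]
      exact gen s t' p hsD hall t (hanc p)
    · have hvX : v ∉ X := Set.disjoint_right.1 hXC hv
      have hset : {i | v ∈ newBag T bag s X C i} = {i | v ∈ bag i} := by
        ext i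
        simp [newBag, hvX, hv]
      rw [hset]
      exact td.conn v trivial

lemma newBag_card [Finite V] {ι : Type} {G : SimpleGraph V} {T : SimpleGraph ι} {bag : ι → Set V}
    (td : TD G Set.univ T bag) {s : ι} {X C : Set V} {B : Set (Set V)} (hB : IsBramble G B)
    (hX : HitsAll B X) (hmin : ∀ Y, HitsAll B Y → X.ncard ≤ Y.ncard)
    (hXC : Disjoint X C) (hN : ∀ u ∈ C, ∀ v, G.Adj u v → v ∈ X ∪ C)
    (hs : HitsAll B (bag s)) (hsC : Disjoint (bag s) C) (t : ι) :
    (newBag T bag s X C t).ncard ≤ (bag t).ncard := by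
  set Ut : Set V := {v | ∃ t', Anc T s t t' ∧ v ∈ bag t'} with hUt
  -- facts about the separation
  have hsub : bag t ⊆ Ut := fun v hv => ⟨t, anc_self _ _ _, hv⟩
  have hsep : ∀ u ∈ Ut, u ∉ bag t → ∀ v, G.Adj u v → v ∈ Ut := by
    rintro u ⟨t', ht', hu⟩ hut v huv
    obtain ⟨i, hi1, hi2⟩ := td.edge u trivial v trivial huv
    exact ⟨i, anc_conn (td.conn u trivial) (by simpa using hut) hu ht' hi1, hi2⟩
  have hroot : ∀ u ∈ bag s, u ∈ Ut → u ∈ bag t := by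
    rintro u hu ⟨t', ht', hu'⟩
    by_contra hut
    have := anc_eq_root (anc_conn (td.conn u trivial) (by simpa using hut) hu' ht' hu)
    exact hut (this ▸ hu)
  have hcov : HitsAll B ((X \ (Ut \ bag t)) ∪ (bag t \ (X ∪ C))) := by
    intro b hb
    by_contra hne
    have hmiss : ∀ v ∈ b, v ∉ X \ (Ut \ bag t) ∧ v ∉ bag t \ (X ∪ C) := by
      intro v hv
      constructor
      · intro h; exact hne ⟨v, hv, Or.inl h⟩
      · intro h; exact hne ⟨v, hv, Or.inr h⟩
    obtain ⟨v0, hv0b, hv0s⟩ := hs b hb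
    have hD : b ⊆ {v | v ∉ X ∪ C ∧ v ∉ Ut} := by
      refine conn_closed (hB.1 b hb).2 hv0b ?_ ?_
      · have h1 := hmiss v0 hv0b
        have h2 := hroot v0 hv0s
        have h3 := Set.disjoint_left.1 hsC hv0s
        simp only [Set.mem_diff, Set.mem_union, Set.mem_setOf_eq] at h1 ⊢
        tauto
      · rintro u hu ⟨hu1, hu2⟩ w hw huw
        have h1 := hmiss w hw
        have h2 : w ∉ C := fun hwC => hu1 (hN w hwC u huw.symm)
        have h3 : w ∈ Ut → w ∈ bag t := by
          intro hw1
          by_contra hw2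
          exact hu2 (hsep w hw1 hw2 u huw.symm)
        simp only [Set.mem_diff, Set.mem_union, Set.mem_setOf_eq] at h1 ⊢
        tauto
    obtain ⟨x, hxb, hxX⟩ := hX b hb
    exact (hD hxb).1 (Or.inl hxX)
  have h1 := hmin _ hcov
  have h2 := Set.ncard_union_le (X \ (Ut \ bag t)) (bag t \ (X ∪ C))
  have h3 : (X \ (Ut \ bag t)).ncard + (X ∩ (Ut \ bag t)).ncard = X.ncard := by
    rw [add_comm]; exact Set.ncard_inter_add_ncard_diff_eq_ncard X _ (Set.toFinite _)
  have h4 : (newBag T bag s X C t).ncard ≤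
      (bag t ∩ (X ∪ C)).ncard + (X ∩ (Ut \ bag t)).ncard := by
    refine (Set.ncard_le_ncard ?_ (Set.toFinite _)).trans (Set.ncard_union_le _ _)
    rintro v (⟨h, h'⟩ | ⟨h, h'⟩)
    · exact Or.inl ⟨h, Or.inr h'⟩
    · by_cases hv : v ∈ bag t
      · exact Or.inl ⟨hv, Or.inl h⟩
      · exact Or.inr ⟨h, h', hv⟩
  have h5 := Set.ncard_inter_add_ncard_diff_eq_ncard (bag t) (X ∪ C) (Set.toFinite _)
  omega

/-- The key step: an admissible decomposition for `insert C B` gives one for `B` on `X ∪ C`. -/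
lemma adm_step [Finite V] {G : SimpleGraph V} {k : ℕ} {X C : Set V} {B : Set (Set V)}
    (hB : IsBramble G B) (hX : HitsAll B X) (hXk : X.ncard ≤ k)
    (hmin : ∀ Y, HitsAll B Y → X.ncard ≤ Y.ncard)
    (hXC : Disjoint X C) (hN : ∀ u ∈ C, ∀ v, G.Adj u v → v ∈ X ∪ C)
    (h : ∃ R, Adm G k (insert C B) Set.univ R) :
    (∃ R, Adm G k B Set.univ R) ∨ Adm G k B (X ∪ C) X := by
  obtain ⟨R, ι, T, bag, s₀, td, hs₀, hadm⟩ := h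
  by_cases hall : ∀ i, k < (bag i).ncard → ¬ HitsAll B (bag i)
  · exact Or.inl ⟨R, ι, T, bag, s₀, td, hs₀, hall⟩
  right
  push Not at hall
  obtain ⟨s, hsk, hs⟩ := hall
  have hsC : Disjoint (bag s) C := by
    rw [Set.disjoint_left]
    intro v hv hvC
    refine hadm s hsk ?_
    rintro b (rfl | hb)
    · exact ⟨v, hvC, hv⟩
    · exact hs b hb
  refine ⟨ι, T, newBag T bag s X C, s, newBag_td td s hXC, ?_, ?_⟩
  · ext v
    constructor
    · rintro (h | h)
      · exact absurd h.2 (Set.disjoint_left.1 hsC h.1)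
      · exact h.1
    · intro hv
      obtain ⟨⟨i, hi⟩⟩ := (td.conn v trivial).nonempty
      exact Or.inr ⟨hv, i, anc_root _ _ _, hi⟩
  · intro t ht hhit
    have hcard := newBag_card td hB hX hmin hXC hN hs hsC t
    have hmeet : (C ∩ bag t).Nonempty := by
      by_contra hno
      have : newBag T bag s X C t ⊆ X := by
        rintro v (h | h)
        · exact absurd ⟨v, h.2, h.1⟩ hno
        · exact h.1
      have := Set.ncard_le_ncard this (Set.toFinite _)
      omega
    have hnot := hadm t (by omega)
    apply hnot
    rintro b (rfl | hb)
    · exact hmeet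
    by_contra hmiss
    obtain ⟨x, hxb, hx | ⟨_, t', hanc, hxt'⟩⟩ := hhit b hb
    · exact hmiss ⟨x, hxb, hx.1⟩
    · have hconn := td.conn_set (hB.1 b hb).2 (Set.subset_univ _)
      have := anc_eq_root (anc_conn hconn hmiss (⟨x, hxb, hxt'⟩ : (b ∩ bag t').Nonempty) hanc
        (hs b hb))
      subst this
      exact hmiss (hs b hb)

/-- Component of `a` in `G - X`. -/
def comp (G : SimpleGraph V) (X : Set V) (a : V) : Set V :=
  {v | Relation.ReflTransGen (fun u w => G.Adj u w ∧ w ∉ X) a v}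

lemma comp_disj (G : SimpleGraph V) {X : Set V} {a : V} (ha : a ∉ X) :
    Disjoint X (comp G X a) := by
  rw [Set.disjoint_right]
  intro v hv
  induction hv with
  | refl => exact ha
  | tail _ h _ => exact h.2

lemma comp_nbr (G : SimpleGraph V) {X : Set V} {a : V} :
    ∀ u ∈ comp G X a, ∀ v, G.Adj u v → v ∈ X ∪ comp G X a := by
  intro u hu v huv
  by_cases hv : v ∈ X
  · exact Or.inl hv
  · exact Or.inr (Relation.ReflTransGen.tail hu ⟨huv, hv⟩)

lemma comp_conn (G : SimpleGraph V) {X : Set V} {a : V} :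
    (G.induce (comp G X a)).Connected := by
  refine conn_of_root (a := a) Relation.ReflTransGen.refl ?_
  intro D haD hcl v hv
  induction hv with
  | refl => exact haD
  | tail h1 h2 ih => exact hcl _ h1 ih _ (Relation.ReflTransGen.tail h1 h2) h2.1

lemma comp_sub (G : SimpleGraph V) {X U : Set V} {a : V} (haU : a ∉ U)
    (hU : ∀ u ∈ U, u ∉ X → ∀ v, G.Adj u v → v ∈ U) (ha : a ∉ X) : Disjoint U (comp G X a) := by
  rw [Set.disjoint_right]
  intro v hv
  induction hv with
  | refl => exact haU
  | tail _ h ih => exact fun hc => ih (hU _ hc h.2 _ h.1.symm)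

lemma exists_min_cover [Finite V] {B : Set (Set V)} (hB : ∀ b ∈ B, b.Nonempty) :
    ∃ X, HitsAll B X ∧ X.ncard = brambleOrder B ∧ ∀ Y, HitsAll B Y → X.ncard ≤ Y.ncard := by
  have hne : {n | ∃ X : Set V, X.Finite ∧ X.ncard = n ∧ HitsAll B X}.Nonempty :=
    ⟨_, Set.univ, Set.toFinite _, rfl, fun b hb => by simpa using hB b hb⟩
  obtain ⟨X, _, h1, h2⟩ := Nat.sInf_mem hne
  refine ⟨X, h2, h1, fun Y hY => ?_⟩
  rw [h1]
  exact Nat.sInf_le ⟨Y, Set.toFinite _, rfl, hY⟩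

lemma order_le_of_hits [Finite V] {B : Set (Set V)} {Y : Set V} (h : HitsAll B Y) :
    brambleOrder B ≤ Y.ncard := Nat.sInf_le ⟨Y, Set.toFinite _, rfl, h⟩

lemma adm_exists [Finite V] (G : SimpleGraph V) (k : ℕ)
    (hk : ∀ B, IsBramble G B → brambleOrder B ≤ k) (B : Set (Set V)) (hB : IsBramble G B) :
    ∃ R, Adm G k B Set.univ R := by
  induction B using (wellFounded_gt (α := Set (Set V))).induction with
  | _ B ih =>
  obtain ⟨X, hX, hXo, hmin⟩ := exists_min_cover (fun b hb => (hB.1 b hb).1)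
  have hXk : X.ncard ≤ k := hXo ▸ hk B hB
  by_contra hcon
  have hcomp : ∀ a, a ∉ X → Adm G k B (X ∪ comp G X a) X := by
    intro a ha
    have hdis := comp_disj G ha
    have hself : a ∈ comp G X a := Relation.ReflTransGen.refl
    by_cases hbr : IsBramble G (insert (comp G X a) B)
    · refine (adm_step hB hX hXk hmin hdis (comp_nbr G) (ih _ ?_ hbr)).resolve_left hcon
      refine Set.ssubset_insert ?_
      intro hmem
      obtain ⟨x, hx1, hx2⟩ := hX _ hmem
      exact Set.disjoint_left.1 hdis hx2 hx1
    · have hb : ∃ b ∈ B, ¬ ((comp G X a ∩ b).Nonempty ∨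
          ∃ u ∈ comp G X a, ∃ v ∈ b, G.Adj u v) := by
        by_contra hno
        push Not at hno
        apply hbr
        refine ⟨?_, ?_⟩
        · rintro S (rfl | hS)
          · exact ⟨⟨a, hself⟩, comp_conn G⟩
          · exact hB.1 S hS
        · rintro S (rfl | hS) S' (rfl | hS')
          · exact Or.inl ⟨a, hself, hself⟩
          · by_cases h0 : (comp G X a ∩ S').Nonempty
            · exact Or.inl h0
            · exact Or.inr ((hno S' hS').resolve_left h0)
          · by_cases h0 : (comp G X a ∩ S).Nonempty
            · exact Or.inl (by rwa [Set.inter_comm])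
            · obtain ⟨u, hu, v, hv, huv⟩ := (hno S hS).resolve_left h0
              exact Or.inr ⟨v, hv, u, hu, huv.symm⟩
          · exact hB.2 S hS S' hS'
      obtain ⟨b, hb, hnt⟩ := hb
      set Y : Set V := comp G X a ∪ {v | ∃ u ∈ comp G X a, G.Adj u v} with hY
      have hYsub : Y ⊆ X ∪ comp G X a := by
        rintro v (hv | ⟨u, hu, huv⟩)
        · exact Or.inr hv
        · exact comp_nbr G u hu v huv
      have hg := adm_glue (adm_single G k B X (fun h => by omega))
        (adm_single G k B Y (fun _ hh => by
          obtain ⟨v, hvb, hv | ⟨u, hu, huv⟩⟩ := hh b hb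
          · exact hnt (Or.inl ⟨v, hv, hvb⟩)
          · exact hnt (Or.inr ⟨u, hu, v, hvb, huv⟩))) subset_rfl (by
          rintro u hu v hv huv
          rcases hYsub hv with h | h
          · exact Or.inr h
          · exact Or.inl (Or.inr ⟨v, h, huv.symm⟩))
      have : X ∪ Y = X ∪ comp G X a := by
        apply Set.Subset.antisymm
        · exact Set.union_subset Set.subset_union_left hYsub
        · exact Set.union_subset_union_right _ Set.subset_union_left
      rwa [this] at hg
  -- take a maximal union of components
  obtain ⟨U, hU, hUmax⟩ := (Set.toFinite {U : Set V | X ⊆ U ∧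
      (∀ u ∈ U, u ∉ X → ∀ v, G.Adj u v → v ∈ U) ∧ Adm G k B U X}).exists_maximal
      ⟨X, subset_rfl, fun u hu hu' => absurd hu hu', adm_single G k B X (fun h => by omega)⟩
  obtain ⟨hXU, hUcl, hUadm⟩ := hU
  by_cases huniv : U = Set.univ
  · exact hcon ⟨X, huniv ▸ hUadm⟩
  · obtain ⟨a, ha⟩ := (Set.ne_univ_iff_exists_notMem U).1 huniv
    have haX : a ∉ X := fun h => ha (hXU h)
    have hd := comp_sub G ha hUcl haX
    have hg := adm_glue hUadm (hcomp a haX) (by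
      rintro v ⟨h1, h2 | h2⟩
      · exact ⟨h2, h2⟩
      · exact absurd h2 (Set.disjoint_left.1 hd h1)) (by
      rintro u hu v hv huv
      by_cases h : u ∈ X
      · exact Or.inl (Or.inl h)
      · exact Or.inr (hUcl u hu h v huv))
    have hmem : U ∪ (X ∪ comp G X a) ∈ {U : Set V | X ⊆ U ∧
      (∀ u ∈ U, u ∉ X → ∀ v, G.Adj u v → v ∈ U) ∧ Adm G k B U X} := by
      refine ⟨hXU.trans Set.subset_union_left, ?_, hg⟩
      rintro u (hu | hu | hu) hux v huv
      · exact Or.inl (hUcl u hu hux v huv)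
      · exact absurd hu hux
      · exact Or.inr (comp_nbr G u hu v huv)
    have := hUmax hmem Set.subset_union_left
    exact ha (this (Or.inr (Or.inr Relation.ReflTransGen.refl)))

lemma treewidth_lt_of_brambles [Finite V] [Nonempty V] (G : SimpleGraph V) (m : ℕ)
    (hm : ∀ B, IsBramble G B → brambleOrder B ≤ m) : treewidth G + 1 ≤ m := by
  have hpos : 1 ≤ m := by
    obtain ⟨a⟩ := ‹Nonempty V›
    have hbr : IsBramble G {{a}} := by
      refine ⟨?_, ?_⟩
      · rintro S rfl
        exact ⟨⟨a, rfl⟩, conn_of_root (a := a) rfl (by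
          rintro D hD _ x rfl; exact hD)⟩
      · rintro S rfl S' rfl
        exact Or.inl ⟨a, rfl, rfl⟩
    obtain ⟨X, hX, hXo, -⟩ := exists_min_cover (fun b hb => (hbr.1 b hb).1)
    obtain ⟨x, -, hx⟩ := hX {a} rfl
    have : 0 < X.ncard := (Set.ncard_pos (Set.toFinite _)).2 ⟨x, hx⟩
    have := hm _ hbr
    omega
  obtain ⟨R, ι, T, bag, s, td, -, hadm⟩ := adm_exists G m hm ∅ ⟨by simp, by simp⟩
  have : HasTreeDecompWidth G (m - 1) := by
    refine ⟨ι, T, bag, td.tree, ?_, fun u v h => td.edge u trivial v trivial h,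
      fun v => td.conn v trivial, fun i => ⟨Set.toFinite _, ?_⟩⟩
    · intro v
      obtain ⟨⟨i, hi⟩⟩ := (td.conn v trivial).nonempty
      exact ⟨i, hi⟩
    · by_contra hc
      exact hadm i (by omega) (by intro b hb; simp at hb)
  have h2 : treewidth G ≤ m - 1 := Nat.sInf_le this
  omega

lemma order_le_treewidth [Finite V] (G : SimpleGraph V) {B : Set (Set V)} (hB : IsBramble G B) :
    brambleOrder B ≤ treewidth G + 1 := by
  have hne : {w | HasTreeDecompWidth G w}.Nonempty := by
    have td := td_single G (Set.univ : Set V)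
    exact ⟨Nat.card V, Unit, ⊥, fun _ => Set.univ, td.tree, fun _ => ⟨(), trivial⟩,
      fun _ _ _ => ⟨(), trivial, trivial⟩, fun v => td.conn v trivial,
      fun _ => ⟨Set.toFinite _, by rw [Set.ncard_univ]; omega⟩⟩
  obtain ⟨ι, T, bag, htree, hcov, hedge, hconn, hcard⟩ := Nat.sInf_mem hne
  have td : TD G Set.univ T bag := ⟨htree, fun _ => Set.subset_univ _,
    fun u _ v _ h => hedge u v h, fun v _ => hconn v⟩
  obtain ⟨t, ht⟩ := td.bag_hits hB
  exact (order_le_of_hits ht).trans (hcard t).2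

/-- If `B` is a maximum-order bramble of `G` and the subfamily of elements of `B`
meeting `X` has order at most `k`, then `tw(G) ≤ tw(G - X) + k`. -/
theorem stmt_1 [Fintype V] (G : SimpleGraph V) (B : Set (Set V)) (X : Set V) (k : ℕ)
    (hB : IsBramble G B)
    (hmax : ∀ B' : Set (Set V), IsBramble G B' → brambleOrder B' ≤ brambleOrder B)
    (hord : brambleOrder (sub B X) ≤ k) :
    treewidth G ≤ treewidth (G.induce Xᶜ) + k := by
  rcases isEmpty_or_nonempty V with hV | hV
  · have : HasTreeDecompWidth G 0 := by
      have td := td_single G (∅ : Set V)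
      exact ⟨Unit, ⊥, fun _ => ∅, td.tree, fun v => isEmptyElim v, fun v => isEmptyElim v,
        fun v => isEmptyElim v, fun _ => ⟨Set.toFinite _, by simp⟩⟩
    have h2 : treewidth G ≤ 0 := Nat.sInf_le this
    omega
  have h1 := treewidth_lt_of_brambles G _ hmax
  obtain ⟨Y, hY, hYo, -⟩ := exists_min_cover (B := sub B X) (fun b hb => (hB.1 b hb.1).1)
  -- the bramble in `G - X`
  let f : (Xᶜ : Set V) → V := Subtype.val
  let B' : Set (Set (Xᶜ : Set V)) := {S | f '' S ∈ B}
  have hsubX : ∀ b ∈ B, b ∉ sub B X → f '' (f ⁻¹' b) = b := by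
    intro b hb hnb
    rw [Set.image_preimage_eq_iff]
    intro v hv
    refine ⟨⟨v, fun hvX => hnb ⟨hb, v, hv, hvX⟩⟩, rfl⟩
  have hB' : IsBramble (G.induce Xᶜ) B' := by
    refine ⟨?_, ?_⟩
    · intro S hS
      obtain ⟨hne, hc⟩ := hB.1 _ hS
      have hne' : S.Nonempty := by simpa using hne
      refine ⟨hne', ?_⟩
      obtain ⟨a, ha⟩ := hne'
      refine conn_of_root ha ?_
      intro D haD hcl
      have : f '' S ⊆ f '' D := by
        refine conn_closed hc ⟨a, ha, rfl⟩ ⟨a, haD, rfl⟩ ?_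
        rintro _ ⟨u, hu, rfl⟩ ⟨u', hu', he⟩ _ ⟨w, hw, rfl⟩ hadj
        have : u' = u := Subtype.val_injective he
        subst this
        exact ⟨w, hcl u' hu hu' w hw (by simpa using hadj), rfl⟩
      exact (Set.image_subset_image_iff Subtype.val_injective).1 this
    · intro S hS S' hS'
      rcases hB.2 _ hS _ hS' with ⟨x, ⟨u, hu, rfl⟩, ⟨u', hu', he⟩⟩ | ⟨_, ⟨u, hu, rfl⟩, _, ⟨v, hv, rfl⟩, h⟩
      · have : u' = u := Subtype.val_injective he
        subst this
        exact Or.inl ⟨u', hu, hu'⟩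
      · exact Or.inr ⟨u, hu, v, hv, by simpa using h⟩
  have h2 := order_le_treewidth (G.induce Xᶜ) hB'
  obtain ⟨Z, hZ, hZo, -⟩ := exists_min_cover (B := B') (fun b hb => (hB'.1 b hb).1)
  have hhit : HitsAll B (Y ∪ f '' Z) := by
    intro b hb
    by_cases hbX : b ∈ sub B X
    · obtain ⟨y, hy1, hy2⟩ := hY b hbX
      exact ⟨y, hy1, Or.inl hy2⟩
    · have he := hsubX b hb hbX
      obtain ⟨z, hz1, hz2⟩ := hZ (f ⁻¹' b) (by change f '' (f ⁻¹' b) ∈ B; rwa [he])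
      exact ⟨f z, hz1, Or.inr ⟨z, hz2, rfl⟩⟩
  have h3 := order_le_of_hits hhit
  have h4 := Set.ncard_union_le Y (f '' Z)
  have h5 : (f '' Z).ncard = Z.ncard := Set.ncard_image_of_injective Z Subtype.val_injective
  omega
end

section
/- Let k be a positive integer, G a graph, P₁ and P₂ two vertex-disjoint paths in G, and Q₁,…,Q_ℓ pairwise vertex-disjoint paths each with one endpoint on P₁ and one endpoint on P₂ and internally disjoint from P₁ ∪ P₂. If ℓ ≥ 2 + 3·c*·k·log₂ k (where c* is a constant witnessing the Erdős–Pósa theorem for cycles), then the graph P₁ ∪ P₂ ∪ Q₁ ∪ ⋯ ∪ Q_ℓ contains at least k pairwise vertex-disjoint cycles, each of which contains at least two of the paths Q₁,…,Q_ℓ. -/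
open SimpleGraph
/-- `G` contains `k` pairwise vertex-disjoint cycles. -/
def HasDisjointCycles (G : SimpleGraph V) (k : ℕ) : Prop :=
  ∃ f : Fin k → Σ v, G.Walk v v, (∀ i, (f i).2.IsCycle) ∧
    ∀ i j, i ≠ j → ∀ x ∈ (f i).2.support, x ∉ (f j).2.support

/-- `c` is a constant witnessing the Erdős–Pósa theorem for cycles. -/
def ErdosPosaConst (c : ℝ) : Prop :=
  1 ≤ c ∧ ∀ (W : Type) (H : SimpleGraph W) (k : ℕ), 0 < k →
    HasDisjointCycles H k ∨ ∃ X : Set W, X.Finite ∧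
      (X.ncard : ℝ) ≤ c * k * Real.logb 2 k ∧
      ∀ (v : W) (w : H.Walk v v), w.IsCycle → ∃ x ∈ X, x ∈ w.support

/-- Attaching a path at one vertex keeps a graph acyclic. -/
lemma attach_path {V : Type} {G : SimpleGraph V} {a b : V} (p : G.Walk a b) :
    p.IsPath → ∀ (A : Set (Sym2 V)) (S : Set V), (∀ e ∈ A, ∀ x ∈ e, x ∈ S) →
    (fromEdgeSet A).IsAcyclic → (∀ x ∈ p.support, x ∈ S → x = a) →
    (fromEdgeSet (A ∪ {e | e ∈ p.edges})).IsAcyclic := by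
  induction p with
  | nil => intro _ A S _ h _; simpa using h
  | @cons a y b h p ih =>
    intro hp A S hA hac hS
    rw [Walk.cons_isPath_iff] at hp
    have hay : a ≠ y := h.ne
    have hyS : y ∉ S := fun hy => hay (hS y (by simp) hy).symm
    have hnr : ¬ (fromEdgeSet A).Reachable a y := by
      intro hr
      obtain ⟨w⟩ := hr.symm
      cases w with
      | nil => exact hay rfl
      | cons h' _ =>
        rw [fromEdgeSet_adj] at h'
        exact hyS (hA _ h'.1 y (by simp))
    have h1 := hac.sup_edge_of_not_reachable hnr
    have h2 : fromEdgeSet A ⊔ edge a y = fromEdgeSet (A ∪ {s(a, y)}) := by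
      rw [edge, fromEdgeSet_union]
    rw [h2] at h1
    have h3 := ih hp.1 (A ∪ {s(a, y)}) (S ∪ {a, y}) (by
      rintro e (he | he) x hx
      · exact Or.inl (hA e he x hx)
      · rw [Set.mem_singleton_iff] at he
        subst he
        right
        simpa using hx) h1 (by
      rintro x hx (hxS | hxS)
      · have := hS x (by simp [hx]) hxS
        subst this
        exact absurd hx hp.2
      · rcases hxS with rfl | hxS
        · exact absurd hx hp.2
        · exact hxS)
    have h4 : A ∪ {e | e ∈ (Walk.cons h p).edges} = A ∪ {s(a, y)} ∪ {e | e ∈ p.edges} := by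
      ext e; simp; tauto
    rw [h4]; exact h3

/-- At most two edges of a path meet a given vertex. -/
lemma path_deg {V : Type} [DecidableEq V] {G : SimpleGraph V} {a b : V} (p : G.Walk a b) (x : V) :
    p.IsPath → (p.edges.toFinset.filter (fun e => x ∈ e)).card ≤ 2 ∧
      (x = a → (p.edges.toFinset.filter (fun e => x ∈ e)).card ≤ 1) ∧
      (x ∉ p.support → (p.edges.toFinset.filter (fun e => x ∈ e)).card = 0) := by
  induction p with
  | nil => intro _; simp
  | @cons a y b h p ih =>
    intro hp
    rw [Walk.cons_isPath_iff] at hp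
    obtain ⟨i1, i2, i3⟩ := ih hp.1
    rw [Walk.edges_cons, List.toFinset_cons, Finset.filter_insert]
    have hay : a ≠ y := h.ne
    by_cases hxa : x = a
    · subst hxa
      have := i3 hp.2
      have h5 := Finset.card_insert_le s(x, y) (p.edges.toFinset.filter (fun e => x ∈ e))
      simp only [Sym2.mem_iff, true_or, if_true]
      refine ⟨by omega, fun _ => by omega, fun h => ?_⟩
      simp at h
    · by_cases hxy : x = y
      · subst hxy
        have := i2 rfl
        have h5 := Finset.card_insert_le s(a, x) (p.edges.toFinset.filter (fun e => x ∈ e))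
        simp only [Sym2.mem_iff, or_true, if_true]
        refine ⟨by omega, fun h => absurd h hxa, fun h => ?_⟩
        simp at h
      · simp only [Sym2.mem_iff, hxa, hxy, or_false, if_false]
        refine ⟨i1, fun h => h.elim, fun h => i3 ?_⟩
        intro h'; exact h (by simp [h'])

/-- A cycle using one edge of a path whose internal vertices have no other edges uses all. -/
lemma cycle_contains {V : Type} {G H : SimpleGraph V} {a b w : V} (q : G.Walk a b)
    (hq : q.IsPath) (C : H.Walk w w) (hC : C.IsCycle)
    (hint : ∀ y ∈ q.support, y ≠ a → y ≠ b → ∀ z, H.Adj y z → s(y, z) ∈ q.edges)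
    (e : Sym2 V) (he : e ∈ q.edges) (heC : e ∈ C.edges) : ∀ e ∈ q.edges, e ∈ C.edges := by
  have key : ∀ i, i + 1 < q.length → (s(q.getVert i, q.getVert (i+1)) ∈ C.edges ↔
      s(q.getVert (i+1), q.getVert (i+2)) ∈ C.edges) := by
    intro i hi
    have hne0 : q.getVert (i+1) ≠ a := by
      rw [Ne, hq.getVert_eq_start_iff (by omega)]; omega
    have hne1 : q.getVert (i+1) ≠ b := by
      rw [Ne, hq.getVert_eq_end_iff (by omega)]; omega
    have hsub : C.toSubgraph.neighborSet (q.getVert (i+1)) ⊆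
        {q.getVert i, q.getVert (i+2)} := by
      intro z hz
      have hz' : C.toSubgraph.Adj (q.getVert (i+1)) z := hz
      have := hint _ (q.getVert_mem_support _) hne0 hne1 z hz'.adj_sub
      rw [← Walk.adj_toSubgraph_iff_mem_edges] at this
      have h2 : z ∈ q.toSubgraph.neighborSet (q.getVert (i+1)) := this
      rw [hq.neighborSet_toSubgraph_internal (by omega) hi] at h2
      simpa using h2
    have both : q.getVert (i+1) ∈ C.support →
        C.toSubgraph.neighborSet (q.getVert (i+1)) = {q.getVert i, q.getVert (i+2)} := by
      intro hs
      apply Set.eq_of_subset_of_ncard_le hsub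
      rw [hC.ncard_neighborSet_toSubgraph_eq_two hs]
      exact (Set.ncard_insert_le _ _).trans (by simp)
    constructor
    · intro h
      have := both (C.mem_support_of_mem_edges h (by simp))
      rw [← Walk.adj_toSubgraph_iff_mem_edges, ← Subgraph.mem_neighborSet, this]
      simp
    · intro h
      have := both (C.mem_support_of_mem_edges h (by simp))
      rw [Sym2.eq_swap, ← Walk.adj_toSubgraph_iff_mem_edges, ← Subgraph.mem_neighborSet, this]
      simp
  have idx : ∀ e ∈ q.edges, ∃ i < q.length, e = s(q.getVert i, q.getVert (i+1)) := by
    intro e he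
    induction e with | _ x y =>
    rw [← Walk.adj_toSubgraph_iff_mem_edges, Walk.toSubgraph_adj_iff] at he
    obtain ⟨i, h1, h2⟩ := he
    exact ⟨i, h2, h1.symm⟩
  have all : ∀ i, i < q.length → (s(q.getVert i, q.getVert (i+1)) ∈ C.edges ↔
      s(q.getVert 0, q.getVert 1) ∈ C.edges) := by
    intro i
    induction i with
    | zero => intro _; rfl
    | succ n ih => intro h; rw [← ih (by omega), key n h]
  obtain ⟨i, hi, rfl⟩ := idx e he
  intro e' he'
  obtain ⟨j, hj, rfl⟩ := idx e' he'
  rw [all j hj, ← all i hi]; exact heC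

/-- An acyclic graph supported on a nonempty set has fewer edges than vertices. -/
lemma acyclic_card {V : Type} [Fintype V] [DecidableEq V] (E : Finset (Sym2 V)) (S : Finset V)
    (hS : S.Nonempty) (hE : ∀ e ∈ E, ¬ e.IsDiag) (hES : ∀ e ∈ E, ∀ x ∈ e, x ∈ S)
    (hac : (fromEdgeSet (E : Set (Sym2 V))).IsAcyclic) : E.card < S.card := by
  classical
  set K := fromEdgeSet (E : Set (Sym2 V)) with hK
  have hedge : K.edgeFinset = E := by
    ext e
    rw [mem_edgeFinset, hK, edgeSet_fromEdgeSet]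
    simp only [Set.mem_sdiff, Finset.mem_coe]
    exact ⟨fun h => h.1, fun h => ⟨h, by simpa using hE e h⟩⟩
  have hsup : K.support ⊆ (S : Set V) := by
    intro x hx
    obtain ⟨y, hy⟩ := hx
    have hy' : K.Adj x y := hy
    rw [hK, fromEdgeSet_adj] at hy'
    exact hES _ hy'.1 x (by simp)
  have h1 := card_edgeFinset_induce_of_support_subset hsup
  have hA := hac.induce (S : Set V)
  have : Nonempty (S : Set V) := hS.to_subtype
  obtain ⟨T, hle, -, hT⟩ := (connected_top (V := (S : Set V))).exists_isTree_le_of_le_of_isAcyclic le_top hA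
  have h2 := hT.card_edgeFinset
  have h3 := Finset.card_le_card (edgeFinset_subset_edgeFinset.2 hle)
  have h4 : Fintype.card (S : Set V) = S.card := by simp
  have h5 : ((induce (S : Set V) K).edgeFinset).card = E.card := by
    refine Eq.trans ?_ (congrArg Finset.card hedge)
    convert h1
  omega

/-- The counting step: a small vertex set misses some cycle. -/
lemma exists_cycle_avoiding {V : Type} [Fintype V] [DecidableEq V] (G : SimpleGraph V) (ℓ : ℕ)
    {a₁ b₁ a₂ b₂ : V} (P₁ : G.Walk a₁ b₁) (P₂ : G.Walk a₂ b₂)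
    (hP₁ : P₁.IsPath) (hP₂ : P₂.IsPath)
    (hP12 : ∀ x ∈ P₁.support, x ∉ P₂.support)
    (u v : Fin ℓ → V) (Q : ∀ i, G.Walk (u i) (v i))
    (hQ : ∀ i, (Q i).IsPath)
    (hu : ∀ i, u i ∈ P₁.support) (hv : ∀ i, v i ∈ P₂.support)
    (hint : ∀ i, ∀ x ∈ (Q i).support, x ≠ u i → x ≠ v i →
      x ∉ P₁.support ∧ x ∉ P₂.support)
    (hQdisj : ∀ i j, i ≠ j → ∀ x ∈ (Q i).support, x ∉ (Q j).support)
    (X : Finset V) (hX : 2 + 3 * X.card ≤ ℓ) :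
    ∃ w, ∃ C : (SimpleGraph.fromEdgeSet
        ({e | e ∈ P₁.edges} ∪ {e | e ∈ P₂.edges} ∪ ⋃ i, {e | e ∈ (Q i).edges})).Walk w w,
      C.IsCycle ∧ ∀ x ∈ X, x ∉ C.support := by
  classical
  -- the indices of paths avoiding `X`
  let B : Finset (Fin ℓ) := Finset.univ.filter (fun i => ∃ x ∈ X, x ∈ (Q i).support)
  let I : Finset (Fin ℓ) := Finset.univ.filter (fun i => ¬ ∃ x ∈ X, x ∈ (Q i).support)
  have hBI : B.card + I.card = ℓ := by
    have := Finset.card_filter_add_card_filter_not (s := (Finset.univ : Finset (Fin ℓ)))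
      (fun i => ∃ x ∈ X, x ∈ (Q i).support)
    simpa [B, I] using this
  have hB : B.card ≤ X.card := by
    have hch : ∀ i, ∃ x, i ∈ B → x ∈ X ∧ x ∈ (Q i).support := by
      intro i
      by_cases hi : i ∈ B
      · obtain ⟨x, hx⟩ := (Finset.mem_filter.1 hi).2
        exact ⟨x, fun _ => hx⟩
      · exact ⟨u i, fun h => absurd h hi⟩
    choose g hg using hch
    apply Finset.card_le_card_of_injOn g (fun i hi => (hg i hi).1)
    intro i hi j hj hij
    by_contra hne
    apply hQdisj i j hne _ (hg i hi).2
    rw [hij]; exact (hg j hj).2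
  have hI : 2 + 2 * X.card ≤ I.card := by omega
  have huv : ∀ i, u i ≠ v i := fun i h => hP12 _ (hu i) (h ▸ hv i)
  have hQP1 : ∀ i x, x ∈ (Q i).support → x ∈ P₁.support → x = u i := by
    intro i x hx hx1
    by_contra h1
    by_cases h2 : x = v i
    · subst h2; exact hP12 _ hx1 (hv i)
    · exact (hint i x hx h1 h2).1 hx1
  have hQP2 : ∀ i x, x ∈ (Q i).support → x ∈ P₂.support → x = v i := by
    intro i x hx hx1
    by_contra h1
    by_cases h2 : x = u i
    · subst h2; exact hP12 _ (hu i) hx1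
    · exact (hint i x hx h2 h1).2 hx1
  have nd : ∀ {a b : V} (p : G.Walk a b) (e : Sym2 V), e ∈ p.edges → ¬ e.IsDiag :=
    fun p e he => G.not_isDiag_of_mem_edgeSet (p.edges_subset_edgeSet he)
  -- two edge sets sharing at most one vertex are disjoint
  have disj : ∀ {a b c d : V} (p : G.Walk a b) (q : G.Walk c d) (z : V),
      (∀ x ∈ p.support, x ∈ q.support → x = z) →
      Disjoint p.edges.toFinset q.edges.toFinset := by
    intro a b c d p q z h
    rw [Finset.disjoint_left]
    intro e he he'
    rw [List.mem_toFinset] at he he'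
    have hnd := nd p e he
    induction e with | _ x y =>
    apply hnd
    rw [Sym2.mk_isDiag_iff]
    rw [h x (p.mem_support_of_mem_edges he (by simp)) (q.mem_support_of_mem_edges he' (by simp)),
      h y (p.mem_support_of_mem_edges he (by simp)) (q.mem_support_of_mem_edges he' (by simp))]
  have ecard : ∀ {a b : V} (p : G.Walk a b), p.IsPath → p.edges.toFinset.card = p.length := by
    intro a b p hp
    rw [List.toFinset_card_of_nodup hp.isTrail.edges_nodup, Walk.length_edges]
  have scard : ∀ {a b : V} (p : G.Walk a b), p.IsPath →
      p.support.toFinset.card = p.length + 1 := by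
    intro a b p hp
    rw [List.toFinset_card_of_nodup hp.support_nodup, Walk.length_support]
  let EQ : Finset (Sym2 V) := I.biUnion (fun i => (Q i).edges.toFinset)
  let E : Finset (Sym2 V) := (P₁.edges.toFinset ∪ P₂.edges.toFinset) ∪ EQ
  have hEQ : EQ.card = ∑ i ∈ I, (Q i).length := by
    rw [Finset.card_biUnion]
    · exact Finset.sum_congr rfl (fun i _ => ecard _ (hQ i))
    · intro i _ j _ hij
      exact disj _ _ (u i) (fun x hx hx' => absurd hx' (hQdisj i j hij x hx))
  have hEcard : E.card = P₁.length + P₂.length + ∑ i ∈ I, (Q i).length := by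
    rw [Finset.card_union_of_disjoint, Finset.card_union_of_disjoint, ecard _ hP₁, ecard _ hP₂, hEQ]
    · exact disj _ _ a₁ (fun x hx hx' => absurd hx' (hP12 x hx))
    · rw [Finset.disjoint_union_left, Finset.disjoint_biUnion_right, Finset.disjoint_biUnion_right]
      exact ⟨fun i _ => disj _ _ (u i) (fun x hx hx' => hQP1 i x hx' hx),
        fun i _ => disj _ _ (v i) (fun x hx hx' => hQP2 i x hx' hx)⟩
  let S : Finset V := (P₁.support.toFinset ∪ P₂.support.toFinset) ∪
    I.biUnion (fun i => (Q i).support.toFinset \ {u i, v i})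
  have hScard : S.card + I.card ≤ P₁.length + P₂.length + 2 + ∑ i ∈ I, (Q i).length := by
    have h1 : S.card ≤ _ := Finset.card_union_le _ _
    have h2 := Finset.card_union_le P₁.support.toFinset P₂.support.toFinset
    rw [scard _ hP₁, scard _ hP₂] at h2
    have h3 : (I.biUnion (fun i => (Q i).support.toFinset \ {u i, v i})).card ≤ _ :=
      Finset.card_biUnion_le
    have h4 : ∑ i ∈ I, (((Q i).support.toFinset \ {u i, v i}).card + 1)
        = ∑ i ∈ I, (Q i).length := by
      apply Finset.sum_congr rfl
      intro i _
      have h5 := Finset.card_sdiff_add_card_eq_card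
        (s := {u i, v i}) (t := (Q i).support.toFinset) (by
          intro x hx
          rw [List.mem_toFinset]
          rcases Finset.mem_insert.1 hx with rfl | hx
          · simp
          · rw [Finset.mem_singleton] at hx; subst hx; simp)
      rw [scard _ (hQ i), Finset.card_pair (huv i)] at h5
      omega
    rw [Finset.sum_add_distrib] at h4
    simp only [Finset.sum_const, smul_eq_mul, mul_one] at h4
    omega
  have hES : ∀ e ∈ E, ∀ x ∈ e, x ∈ S := by
    intro e he x hx
    simp only [E, EQ, Finset.mem_union, List.mem_toFinset, Finset.mem_biUnion] at he
    simp only [S, Finset.mem_union, List.mem_toFinset, Finset.mem_biUnion, Finset.mem_sdiff,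
      Finset.mem_insert, Finset.mem_singleton]
    rcases he with (he | he) | ⟨i, hi, he⟩
    · exact Or.inl (Or.inl (P₁.mem_support_of_mem_edges he hx))
    · exact Or.inl (Or.inr (P₂.mem_support_of_mem_edges he hx))
    · have hxs := (Q i).mem_support_of_mem_edges he hx
      by_cases h1 : x = u i
      · subst h1; exact Or.inl (Or.inl (hu i))
      by_cases h2 : x = v i
      · subst h2; exact Or.inl (Or.inr (hv i))
      exact Or.inr ⟨i, hi, hxs, by simp [h1, h2]⟩
  -- remove the edges meeting `X`
  let R : Finset (Sym2 V) := X.biUnion (fun x => E.filter (fun e => x ∈ e))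
  have hR : R.card ≤ X.card * 2 := by
    apply Finset.card_biUnion_le_card_mul
    intro x hx
    have h1 : E.filter (fun e => x ∈ e) ⊆ P₁.edges.toFinset.filter (fun e => x ∈ e) ∪
        P₂.edges.toFinset.filter (fun e => x ∈ e) := by
      intro e he
      rw [Finset.mem_filter] at he
      obtain ⟨he, hxe⟩ := he
      simp only [E, EQ, Finset.mem_union, List.mem_toFinset, Finset.mem_biUnion] at he
      simp only [Finset.mem_union, Finset.mem_filter, List.mem_toFinset]
      rcases he with (he | he) | ⟨i, hi, he⟩
      · exact Or.inl ⟨he, hxe⟩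
      · exact Or.inr ⟨he, hxe⟩
      · exact absurd ⟨x, hx, (Q i).mem_support_of_mem_edges he hxe⟩ (Finset.mem_filter.1 hi).2
    have h2 := (Finset.card_le_card h1).trans (Finset.card_union_le _ _)
    obtain ⟨p1, -, p3⟩ := path_deg P₁ x hP₁
    obtain ⟨q1, -, q3⟩ := path_deg P₂ x hP₂
    by_cases hx1 : x ∈ P₁.support
    · have := q3 (hP12 x hx1)
      omega
    · have := p3 hx1
      omega
  have hcard : E.card - R.card ≤ (E \ R).card := Finset.le_card_sdiff _ _
  have hnac : ¬ (fromEdgeSet ((E \ R : Finset (Sym2 V)) : Set (Sym2 V))).IsAcyclic := by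
    intro hac
    have := acyclic_card (E \ R) S ⟨a₁, by simp [S]⟩ (by
      intro e he
      have he := (Finset.mem_sdiff.1 he).1
      simp only [E, EQ, Finset.mem_union, List.mem_toFinset, Finset.mem_biUnion] at he
      rcases he with (he | he) | ⟨i, hi, he⟩
      · exact nd _ _ he
      · exact nd _ _ he
      · exact nd _ _ he) (fun e he => hES e (Finset.mem_sdiff.1 he).1) hac
    omega
  simp only [IsAcyclic, not_forall, not_not] at hnac
  obtain ⟨w, C, hC⟩ := hnac
  have hle : fromEdgeSet ((E \ R : Finset (Sym2 V)) : Set (Sym2 V)) ≤ fromEdgeSet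
      ({e | e ∈ P₁.edges} ∪ {e | e ∈ P₂.edges} ∪ ⋃ i, {e | e ∈ (Q i).edges}) := by
    apply fromEdgeSet_mono
    intro e he
    have he := (Finset.mem_sdiff.1 (Finset.mem_coe.1 he)).1
    simp only [E, EQ, Finset.mem_union, List.mem_toFinset, Finset.mem_biUnion] at he
    rcases he with (he | he) | ⟨i, hi, he⟩
    · exact Or.inl (Or.inl he)
    · exact Or.inl (Or.inr he)
    · exact Or.inr (Set.mem_iUnion.2 ⟨i, he⟩)
  refine ⟨w, C.mapLe hle, hC.mapLe hle, ?_⟩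
  intro x hx hxC
  rw [Walk.support_mapLe_eq_support, Walk.mem_support_iff_exists_mem_edges_of_not_nil hC.not_nil]
    at hxC
  obtain ⟨e, he, hxe⟩ := hxC
  have h1 := C.edges_subset_edgeSet he
  rw [edgeSet_fromEdgeSet] at h1
  have h2 := Finset.mem_sdiff.1 (Finset.mem_coe.1 h1.1)
  exact h2.2 (Finset.mem_biUnion.2 ⟨x, hx, Finset.mem_filter.2 ⟨h2.1, hxe⟩⟩)

/-- Given two disjoint paths `P₁, P₂` linked by `ℓ ≥ 2 + 3c*·k·log₂ k` disjoint
paths `Qᵢ` internally disjoint from them, their union contains `k` disjoint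
cycles, each containing at least two of the `Qᵢ`. -/
theorem stmt_5 {V : Type} [Fintype V] (G : SimpleGraph V) (k ℓ : ℕ) (hk : 0 < k)
    (c : ℝ) (hc : ErdosPosaConst c)
    {a₁ b₁ a₂ b₂ : V} (P₁ : G.Walk a₁ b₁) (P₂ : G.Walk a₂ b₂)
    (hP₁ : P₁.IsPath) (hP₂ : P₂.IsPath)
    (hP12 : ∀ x ∈ P₁.support, x ∉ P₂.support)
    (u v : Fin ℓ → V) (Q : ∀ i, G.Walk (u i) (v i))
    (hQ : ∀ i, (Q i).IsPath)
    (hu : ∀ i, u i ∈ P₁.support) (hv : ∀ i, v i ∈ P₂.support)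
    (hint : ∀ i, ∀ x ∈ (Q i).support, x ≠ u i → x ≠ v i →
      x ∉ P₁.support ∧ x ∉ P₂.support)
    (hQdisj : ∀ i j, i ≠ j → ∀ x ∈ (Q i).support, x ∉ (Q j).support)
    (hl : 2 + 3 * c * k * Real.logb 2 k ≤ (ℓ : ℝ)) :
    ∃ f : Fin k → Σ w, (SimpleGraph.fromEdgeSet
        ({e | e ∈ P₁.edges} ∪ {e | e ∈ P₂.edges} ∪ ⋃ i, {e | e ∈ (Q i).edges})).Walk w w,
      (∀ j, (f j).2.IsCycle) ∧
      (∀ j j', j ≠ j' → ∀ x ∈ (f j).2.support, x ∉ (f j').2.support) ∧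
      ∀ j, ∃ i₁ i₂ : Fin ℓ, i₁ ≠ i₂ ∧
        (∀ e ∈ (Q i₁).edges, e ∈ (f j).2.edges) ∧
        (∀ e ∈ (Q i₂).edges, e ∈ (f j).2.edges) := by
  classical
  set H := SimpleGraph.fromEdgeSet
        ({e | e ∈ P₁.edges} ∪ {e | e ∈ P₂.edges} ∪ ⋃ i, {e | e ∈ (Q i).edges}) with hH
  have hc1 := hc.1
  have hlog : 0 ≤ Real.logb 2 k := by
    apply Real.logb_nonneg (by norm_num)
    exact_mod_cast hk
  have hcyc : HasDisjointCycles H k := by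
    rcases hc.2 V H k hk with h | ⟨X, hXf, hXc, hX⟩
    · exact h
    exfalso
    have hXn : 2 + 3 * hXf.toFinset.card ≤ ℓ := by
      rw [← Set.ncard_eq_toFinset_card X hXf]
      have : (2 + 3 * (X.ncard : ℝ)) ≤ ℓ := by linarith
      exact_mod_cast this
    obtain ⟨w, C, hC, hav⟩ := exists_cycle_avoiding G ℓ P₁ P₂ hP₁ hP₂ hP12 u v Q hQ hu hv hint
      hQdisj hXf.toFinset hXn
    obtain ⟨x, hx, hxC⟩ := hX w C hC
    exact hav x (by simpa using hx) hxC
  have hl2 : 2 ≤ ℓ := by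
    have : (2 : ℝ) ≤ ℓ := by
      have : 0 ≤ 3 * c * k * Real.logb 2 k := by positivity
      linarith
    exact_mod_cast this
  obtain ⟨f, hf, hfd⟩ := hcyc
  refine ⟨f, hf, hfd, fun j => ?_⟩
  have hedge : ∀ e ∈ H.edgeSet, e ∈ P₁.edges ∨ e ∈ P₂.edges ∨ ∃ i, e ∈ (Q i).edges := by
    intro e he
    rw [hH, edgeSet_fromEdgeSet] at he
    rcases he.1 with (he | he) | he
    · exact Or.inl he
    · exact Or.inr (Or.inl he)
    · exact Or.inr (Or.inr (Set.mem_iUnion.1 he))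
  -- a path meeting the cycle in an edge lies in it
  have hall : ∀ i, (∃ e ∈ (Q i).edges, e ∈ (f j).2.edges) →
      ∀ e ∈ (Q i).edges, e ∈ (f j).2.edges := by
    rintro i ⟨e, he, heC⟩
    refine cycle_contains (Q i) (hQ i) (f j).2 (hf j) ?_ e he heC
    intro y hy hyu hyv z hyz
    obtain ⟨n1, n2⟩ := hint i y hy hyu hyv
    rcases hedge s(y, z) hyz with h | h | ⟨i', h⟩
    · exact absurd (P₁.mem_support_of_mem_edges h (by simp)) n1
    · exact absurd (P₂.mem_support_of_mem_edges h (by simp)) n2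
    · by_cases hii : i = i'
      · subst hii; exact h
      · exact absurd ((Q i').mem_support_of_mem_edges h (by simp)) (hQdisj i i' hii y hy)
  by_contra hno
  -- all path edges of the cycle come from a single path
  have hone : ∃ i₀ : Fin ℓ, ∀ i, (∃ e ∈ (Q i).edges, e ∈ (f j).2.edges) → i = i₀ := by
    by_cases hex : ∃ i₀, ∃ e ∈ (Q i₀).edges, e ∈ (f j).2.edges
    · obtain ⟨i₀, h₀⟩ := hex
      refine ⟨i₀, fun i hi => ?_⟩
      by_contra hne
      exact hno ⟨i, i₀, hne, hall i hi, hall i₀ h₀⟩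
    · exact ⟨⟨0, by omega⟩, fun i hi => absurd ⟨i, hi⟩ hex⟩
  obtain ⟨i₀, hi₀⟩ := hone
  have hac : (fromEdgeSet ({e | e ∈ P₁.edges} ∪ {e | e ∈ (Q i₀).edges} ∪
      {e | e ∈ P₂.edges})).IsAcyclic := by
    have h1 := attach_path P₁ hP₁ ∅ ∅ (by simp) (by simp) (by simp)
    rw [Set.empty_union] at h1
    have h2 := attach_path (Q i₀) (hQ i₀) _ {x | x ∈ P₁.support}
      (fun e he x hx => P₁.mem_support_of_mem_edges he hx) h1 (by
        intro x hx hx1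
        by_contra h1
        by_cases h2 : x = v i₀
        · subst h2; exact hP12 _ hx1 (hv i₀)
        · exact (hint i₀ x hx h1 h2).1 hx1)
    have hmeet : ∀ x ∈ P₂.support, x ∈ P₁.support ∨ x ∈ (Q i₀).support → x = v i₀ := by
      rintro x hx2 (hx | hx)
      · exact absurd hx2 (hP12 x hx)
      · by_contra h1
        by_cases h2 : x = u i₀
        · subst h2; exact hP12 _ (hu i₀) hx2
        · exact (hint i₀ x hx h2 h1).2 hx2
    have h3 := attach_path (P₂.dropUntil _ (hv i₀)) (hP₂.dropUntil (hv i₀)) _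
      {x | x ∈ P₁.support ∨ x ∈ (Q i₀).support} (by
        rintro e (he | he) x hx
        · exact Or.inl (P₁.mem_support_of_mem_edges he hx)
        · exact Or.inr ((Q i₀).mem_support_of_mem_edges he hx)) h2
      (fun x hx hx' => hmeet x (P₂.support_dropUntil_subset_support (hv i₀) hx) hx')
    have h4 := attach_path (P₂.takeUntil _ (hv i₀)).reverse (hP₂.takeUntil (hv i₀)).reverse _
      {x | (x ∈ P₁.support ∨ x ∈ (Q i₀).support) ∨ x ∈ (P₂.dropUntil _ (hv i₀)).support} (by
        rintro e ((he | he) | he) x hx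
        · exact Or.inl (Or.inl (P₁.mem_support_of_mem_edges he hx))
        · exact Or.inl (Or.inr ((Q i₀).mem_support_of_mem_edges he hx))
        · exact Or.inr (Walk.mem_support_of_mem_edges he hx)) h3 (by
        intro x hx hx'
        rw [Walk.support_reverse, List.mem_reverse] at hx
        rcases hx' with hx' | hx'
        · exact hmeet x (P₂.support_takeUntil_subset_support (hv i₀) hx) hx'
        · by_contra hne
          have hsp := P₂.take_spec (hv i₀)
          have hnd := hP₂.support_nodup
          rw [← hsp, Walk.support_append] at hnd
          have hd := List.disjoint_of_nodup_append hnd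
          rw [← Walk.cons_tail_support, List.mem_cons] at hx'
          exact hd hx (hx'.resolve_left hne))
    refine h4.anti (fromEdgeSet_mono ?_)
    rintro e (he | he)
    · exact Or.inl (Or.inl he)
    · have he' : e ∈ P₂.edges := he
      rw [← P₂.take_spec (hv i₀), Walk.edges_append, List.mem_append] at he'
      rcases he' with he' | he'
      · right
        simpa using he'
      · exact Or.inl (Or.inr he')
  have hsub : ∀ e ∈ (f j).2.edges, e ∈ (fromEdgeSet ({e | e ∈ P₁.edges} ∪
      {e | e ∈ (Q i₀).edges} ∪ {e | e ∈ P₂.edges})).edgeSet := by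
    intro e he
    have heH := (f j).2.edges_subset_edgeSet he
    rw [edgeSet_fromEdgeSet]
    refine ⟨?_, H.not_isDiag_of_mem_edgeSet heH⟩
    rcases hedge e heH with h | h | ⟨i, h⟩
    · exact Or.inl (Or.inl h)
    · exact Or.inr h
    · have := hi₀ i ⟨e, h, he⟩
      subst this
      exact Or.inl (Or.inr h)
  exact hac _ ((hf j).transfer hsub)
end

section
/- Let t be a positive integer and B a bramble of order at least 2t + 1 in a graph G. Then there exist two vertex-disjoint paths P₁ and P₂ in G such that both B_{V(P₁)} and B_{V(P₂)} (the subfamilies of elements of B meeting V(P₁), resp. V(P₂)) have order exactly t, together with t pairwise vertex-disjoint paths Q₁,…,Q_t, each having one endpoint on P₁ and one endpoint on P₂ and internally disjoint from P₁ ∪ P₂. -/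
open SimpleGraph

variable {V : Type*}

/-! ### Orders -/

theorem order_le [Fintype V] {B : Set (Set V)} {X : Set V} (h : HitsAll B X) :
    brambleOrder B ≤ X.ncard :=
  Nat.sInf_le ⟨X, X.toFinite, rfl, h⟩

theorem exists_hit [Fintype V] {B : Set (Set V)} (hne : ∀ S ∈ B, S.Nonempty) :
    ∃ X : Set V, X.ncard = brambleOrder B ∧ HitsAll B X := by
  have h : {n | ∃ X : Set V, X.Finite ∧ X.ncard = n ∧ HitsAll B X}.Nonempty :=
    ⟨_, Set.univ, Set.toFinite _, rfl, fun S hS => by simpa using hne S hS⟩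
  obtain ⟨X, -, h1, h2⟩ := Nat.sInf_mem h
  exact ⟨X, h1, h2⟩

theorem sub_ne {B : Set (Set V)} (hne : ∀ S ∈ B, S.Nonempty) (X : Set V) :
    ∀ S ∈ sub B X, S.Nonempty := fun S hS => hne S hS.1

theorem order_sub_union [Fintype V] {B : Set (Set V)} (hne : ∀ S ∈ B, S.Nonempty) (X Y Z : Set V)
    (h : Z ⊆ X ∪ Y) :
    brambleOrder (sub B Z) ≤ brambleOrder (sub B X) + brambleOrder (sub B Y) := by
  obtain ⟨H, h1, h2⟩ := exists_hit (sub_ne hne X)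
  obtain ⟨K, k1, k2⟩ := exists_hit (sub_ne hne Y)
  rw [← h1, ← k1]
  refine (order_le ?_).trans (Set.ncard_union_le H K)
  rintro S ⟨hS, z, hzS, hz⟩
  rcases h hz with hz | hz
  · exact (h2 S ⟨hS, z, hzS, hz⟩).mono (by gcongr; simp)
  · exact (k2 S ⟨hS, z, hzS, hz⟩).mono (by gcongr; simp)

theorem order_sub_singleton [Fintype V] {B : Set (Set V)} (x : V) :
    brambleOrder (sub B {x}) ≤ 1 := by
  rw [← Set.ncard_singleton x]
  exact order_le fun S hS => hS.2

theorem order_sub_empty [Fintype V] {B : Set (Set V)} :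
    brambleOrder (sub B ∅) = 0 := by
  have : brambleOrder (sub B ∅) ≤ (∅ : Set V).ncard := order_le fun S hS => hS.2
  simpa using this

theorem exists_take [Fintype V] {B : Set (Set V)} (hne : ∀ S ∈ B, S.Nonempty) (t : ℕ)
    (L : List V) (h : t ≤ brambleOrder (sub B {x | x ∈ L})) :
    ∃ n, brambleOrder (sub B {x | x ∈ L.take n}) = t := by
  classical
  have hex : ∃ n, t ≤ brambleOrder (sub B {x | x ∈ L.take n}) := ⟨L.length, by simpa using h⟩
  refine ⟨Nat.find hex, le_antisymm ?_ (Nat.find_spec hex)⟩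
  rcases hn : Nat.find hex with _ | n
  · simp [order_sub_empty]
  · have hlt := Nat.find_min hex (m := n) (by omega)
    by_cases hl : n < L.length
    · have := order_sub_union hne {x | x ∈ L.take n} {L[n]} {x | x ∈ L.take (n+1)} (by
        intro z hz
        simp only [Set.mem_ofPred_eq, ← List.take_concat_get' _ _ hl, List.mem_append] at hz
        simpa [or_comm] using hz)
      have := order_sub_singleton (B := B) L[n]
      omega
    · rw [List.take_of_length_le (by omega)] at hlt ⊢
      omega

/-! ### A path hitting the bramble -/

theorem walk_in {G : SimpleGraph V} {S : Set V} (h : (G.induce S).Connected) {a b : V}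
    (ha : a ∈ S) (hb : b ∈ S) : ∃ w : G.Walk a b, ∀ z ∈ w.support, z ∈ S := by
  obtain ⟨w⟩ := h.preconnected ⟨a, ha⟩ ⟨b, hb⟩
  have h2 : ∀ z ∈ (w.map (Embedding.induce (G := G) S).toHom).support, z ∈ S := by
    intro z hz
    rw [Walk.support_map] at hz
    obtain ⟨y, -, rfl⟩ := List.mem_map.1 hz
    exact y.2
  exact ⟨w.map (Embedding.induce (G := G) S).toHom, h2⟩

theorem walk_touch {G : SimpleGraph V} {B : Set (Set V)} (hB : IsBramble G B) {S T : Set V}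
    (hS : S ∈ B) (hT : T ∈ B) {a b : V} (ha : a ∈ S) (hb : b ∈ T) :
    ∃ w : G.Walk a b, ∀ z ∈ w.support, z ∈ S ∨ z ∈ T := by
  rcases hB.2 S hS T hT with ⟨c, hc1, hc2⟩ | ⟨c, hc, d, hd, hcd⟩
  · obtain ⟨w1, h1⟩ := walk_in (hB.1 S hS).2 ha hc1
    obtain ⟨w2, h2⟩ := walk_in (hB.1 T hT).2 hc2 hb
    refine ⟨w1.append w2, fun z hz => ?_⟩
    rw [Walk.mem_support_append_iff] at hz
    exact hz.imp (h1 z) (h2 z)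
  · obtain ⟨w1, h1⟩ := walk_in (hB.1 S hS).2 ha hc
    obtain ⟨w2, h2⟩ := walk_in (hB.1 T hT).2 hd hb
    refine ⟨w1.append (Walk.cons hcd w2), fun z hz => ?_⟩
    rw [Walk.mem_support_append_iff, Walk.support_cons, List.mem_cons] at hz
    rcases hz with hz | rfl | hz
    · exact Or.inl (h1 z hz)
    · exact Or.inl hc
    · exact Or.inr (h2 z hz)

theorem hitting_path [Fintype V] {G : SimpleGraph V} {B : Set (Set V)} (hB : IsBramble G B)
    (hne : B.Nonempty) :
    ∃ (a b : V) (P : G.Walk a b), P.IsPath ∧ HitsAll B {x | x ∈ P.support} := by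
  classical
  by_contra hno
  have key : ∀ n : ℕ, ∃ (v a : V) (P : G.Walk v a), P.IsPath ∧ P.length = n ∧
      ∀ T ∈ B, (∀ z ∈ T, z ∉ P.support) → ∀ t ∈ T, ∃ q : G.Walk v t,
        ∀ z ∈ q.support, z ∈ P.support → z = v := by
    intro n
    induction n with
    | zero =>
      obtain ⟨S, hS⟩ := hne
      obtain ⟨v, hv⟩ := (hB.1 S hS).1
      refine ⟨v, v, Walk.nil, by simp, rfl, fun T hT _ t ht => ?_⟩
      obtain ⟨w, -⟩ := walk_touch hB hS hT hv ht
      exact ⟨w, by simp⟩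
    | succ n ih =>
      obtain ⟨v, a, P, hP, hl, hI⟩ := ih
      have hnh : ¬ HitsAll B {x | x ∈ P.support} := fun h => hno ⟨_, _, P, hP, h⟩
      simp only [HitsAll, not_forall] at hnh
      obtain ⟨T, hT, hTP⟩ := hnh
      have hTP' : ∀ z ∈ T, z ∉ P.support := fun z hz hz' => hTP ⟨z, hz, hz'⟩
      obtain ⟨t, ht⟩ := (hB.1 T hT).1
      obtain ⟨q, hq⟩ := hI T hT hTP' t ht
      have hq' : ∀ z ∈ q.bypass.support, z ∈ P.support → z = v :=
        fun z hz => hq z (q.support_bypass_subset_support hz)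
      have hqp := q.bypass_isPath
      generalize q.bypass = r at hq' hqp
      cases r with
      | nil => exact absurd P.start_mem_support (hTP' _ ht)
      | @cons _ w _ h r =>
        rw [Walk.cons_isPath_iff] at hqp
        have hr : ∀ z ∈ r.support, z ∉ P.support := by
          intro z hz hzP
          have := hq' z (by simp [hz]) hzP
          exact hqp.2 (this ▸ hz)
        refine ⟨w, a, Walk.cons h.symm P, ?_, by simp [hl], ?_⟩
        · rw [Walk.cons_isPath_iff]
          exact ⟨hP, hr _ r.start_mem_support⟩
        · intro T' hT' hT'P t' ht'
          obtain ⟨w2, hw2⟩ := walk_touch hB hT hT' ht ht'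
          refine ⟨r.append w2, fun z hz hzP => ?_⟩
          rw [Walk.support_cons, List.mem_cons] at hzP
          rcases hzP with h | hzP
          · exact h
          rw [Walk.mem_support_append_iff] at hz
          exfalso
          rcases hz with hz | hz
          · exact hr z hz hzP
          · rcases hw2 z hz with hz | hz
            · exact hTP' z hz hzP
            · exact hT'P z hz (by simp [hzP])
  obtain ⟨v, a, P, hP, hl, -⟩ := key (Fintype.card V)
  have := hP.length_lt
  omega

/-! ### Normalising walks -/

theorem normal_walk {G : SimpleGraph V} (A C X : Set V) {a c : V} (w : G.Walk a c)
    (ha : a ∈ A) (hc : c ∈ C) (hX : ∀ z ∈ w.support, z ∈ X) :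
    ∃ (u v : V) (q : G.Walk u v), q.IsPath ∧ u ∈ A ∧ v ∈ C ∧ (∀ z ∈ q.support, z ∈ X) ∧
      ∀ x ∈ q.support, x ≠ u → x ≠ v → x ∉ A ∧ x ∉ C := by
  classical
  have hex : ∃ n, ∃ (u v : V) (q : G.Walk u v), u ∈ A ∧ v ∈ C ∧ (∀ z ∈ q.support, z ∈ X) ∧
      q.length = n := ⟨_, a, c, w, ha, hc, hX, rfl⟩
  obtain ⟨u, v, q, hu, hv, hq, hn⟩ := Nat.find_spec hex
  have hmin : ∀ (u' v' : V) (q' : G.Walk u' v'), u' ∈ A → v' ∈ C → (∀ z ∈ q'.support, z ∈ X) →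
      q.length ≤ q'.length := fun u' v' q' h1 h2 h3 => by
    rw [hn]; exact Nat.find_min' hex ⟨u', v', q', h1, h2, h3, rfl⟩
  have hle := q.length_bypass_le_length
  have hsub : ∀ z ∈ q.bypass.support, z ∈ X := fun z hz => hq z (q.support_bypass_subset_support hz)
  have hp := q.bypass_isPath
  generalize q.bypass = r at hle hsub hp
  refine ⟨u, v, r, hp, hu, hv, hsub, fun x hx hxu hxv => ?_⟩
  have hlen : (r.takeUntil x hx).length + (r.dropUntil x hx).length = r.length := by
    rw [← Walk.length_append, Walk.take_spec]
  constructor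
  · intro hxA
    have := hmin _ _ (r.dropUntil x hx) hxA hv
      (fun z hz => hsub z (r.support_dropUntil_subset_support hx hz))
    exact hxu (Walk.eq_of_length_eq_zero (p := r.takeUntil x hx) (by omega)).symm
  · intro hxC
    have := hmin _ _ (r.takeUntil x hx) hu hxC
      (fun z hz => hsub z (r.support_takeUntil_subset_support hx hz))
    exact hxv (Walk.eq_of_length_eq_zero (p := r.dropUntil x hx) (by omega))

/-! ### Menger's theorem (directed, Göring's proof) -/

/-- `l` is a directed walk from `A` to `C` with edges in `E`. -/
def IsDW (E : Finset (V × V)) (A C : Set V) (l : List V) : Prop :=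
  l.IsChain (fun a b => (a, b) ∈ E) ∧ (∃ a ∈ l.head?, a ∈ A) ∧ (∃ c ∈ l.getLast?, c ∈ C)

theorem first_hit (P : Set V) (l : List V) (h : ∃ x ∈ l, x ∈ P) :
    ∃ l1 b l2, l = l1 ++ b :: l2 ∧ b ∈ P ∧ ∀ x ∈ l1, x ∉ P := by
  induction l with
  | nil => simp at h
  | cons a l ih =>
    by_cases ha : a ∈ P
    · exact ⟨[], a, l, rfl, ha, by simp⟩
    · obtain ⟨l1, b, l2, rfl, hb, h1⟩ := ih (by
        obtain ⟨x, hx, hxP⟩ := h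
        rcases List.mem_cons.1 hx with rfl | hx
        · exact absurd hxP ha
        · exact ⟨x, hx, hxP⟩)
      exact ⟨a :: l1, b, l2, rfl, hb, by simpa [ha] using h1⟩

theorem last_hit (P : Set V) (l : List V) (h : ∃ x ∈ l, x ∈ P) :
    ∃ l1 b l2, l = l1 ++ b :: l2 ∧ b ∈ P ∧ ∀ x ∈ l2, x ∉ P := by
  obtain ⟨l1, b, l2, h1, hb, h2⟩ := first_hit P l.reverse (by simpa using h)
  refine ⟨l2.reverse, b, l1.reverse, ?_, hb, by simpa using h2⟩
  rw [← l.reverse_reverse, h1]; simp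

theorem isDW_prefix {E : Finset (V × V)} {A C P : Set V} {l1 l2 : List V} {b : V}
    (h : IsDW E A C (l1 ++ b :: l2)) (hb : b ∈ P) : IsDW E A P (l1 ++ [b]) := by
  obtain ⟨h1, ⟨a, ha, haA⟩, -⟩ := h
  refine ⟨(List.isChain_split.1 h1).1, ⟨a, ?_, haA⟩, b, by simp, hb⟩
  cases l1 <;> simpa using ha

theorem isDW_suffix {E : Finset (V × V)} {A C P : Set V} {l1 l2 : List V} {b : V}
    (h : IsDW E A C (l1 ++ b :: l2)) (hb : b ∈ P) : IsDW E P C (b :: l2) := by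
  obtain ⟨h1, -, c, hc, hcC⟩ := h
  refine ⟨(List.isChain_split.1 h1).2, ⟨b, by simp, hb⟩, c, ?_, hcC⟩
  simpa [List.getLast?_append] using hc

theorem isDW_glue {E : Finset (V × V)} {A C P Q : Set V} {l1 l2 : List V} {b : V}
    (h1 : IsDW E A P (l1 ++ [b])) (h2 : IsDW E Q C (b :: l2)) : IsDW E A C (l1 ++ b :: l2) := by
  obtain ⟨c1, ⟨a, ha, haA⟩, -⟩ := h1
  obtain ⟨c2, -, c, hc, hcC⟩ := h2
  refine ⟨List.isChain_split.2 ⟨c1, c2⟩, ⟨a, ?_, haA⟩, c, ?_, hcC⟩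
  · cases l1 <;> simpa using ha
  · simpa [List.getLast?_append] using hc

theorem isDW_glue_edge {E : Finset (V × V)} {A C P Q : Set V} {l1 l2 : List V} {b d : V}
    (h1 : IsDW E A P (l1 ++ [b])) (h2 : IsDW E Q C (d :: l2)) (hbd : (b, d) ∈ E) :
    IsDW E A C (l1 ++ b :: d :: l2) := by
  refine isDW_glue h1 (Q := {b}) ⟨?_, ⟨b, by simp, rfl⟩, ?_⟩
  · exact List.isChain_cons_cons.2 ⟨hbd, h2.1⟩
  · obtain ⟨-, -, c, hc, hcC⟩ := h2
    exact ⟨c, by simpa using hc, hcC⟩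

theorem isDW_mono {E F : Finset (V × V)} {A C : Set V} {l : List V} (hEF : E ⊆ F)
    (h : IsDW E A C l) : IsDW F A C l := ⟨h.1.imp fun _ _ h => hEF h, h.2⟩

/-- Normal form of linkages ending exactly in `P`. -/
theorem linkage_to [Fintype V] {E : Finset (V × V)} {A : Set V} (P : Finset V) {k : ℕ}
    (hk : P.card = k) (p : Fin k → List V) (hp : ∀ i, IsDW E A P (p i))
    (hd : ∀ i j, i ≠ j → ∀ x ∈ p i, x ∉ p j) :
    ∃ l : P → List V, (∀ s, IsDW E A P (l s ++ [s.1])) ∧ (∀ s, ∀ x ∈ l s, x ∉ P) ∧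
      ∀ s s', s ≠ s' → ∀ x ∈ l s ++ [s.1], x ∉ l s' ++ [s'.1] := by
  have h : ∀ i, ∃ (l1 : List V) (b : P), IsDW E A P (l1 ++ [b.1]) ∧ (∀ x ∈ l1, x ∉ P) ∧
      ∀ x ∈ l1 ++ [b.1], x ∈ p i := by
    intro i
    obtain ⟨l1, b, l2, h1, h2, h3⟩ := first_hit (P : Set V) (p i) (by
      obtain ⟨-, -, c, hc, hcC⟩ := hp i
      exact ⟨c, List.mem_of_getLast? hc, hcC⟩)
    refine ⟨l1, ⟨b, h2⟩, ?_, by simpa using h3, ?_⟩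
    · exact isDW_prefix (h1 ▸ hp i) h2
    · rw [h1]; intro x hx; simp at hx ⊢; tauto
  choose l b h1 h2 h3 using h
  have hinj : Function.Injective b := by
    intro i j hij
    by_contra hne
    exact hd i j hne (b i).1 (h3 i _ (by simp)) (h3 j _ (by simp [hij]))
  have hsurj : Function.Surjective b :=
    ((Fintype.bijective_iff_injective_and_card b).2 ⟨hinj, by simp [hk]⟩).2
  choose g hg using hsurj
  refine ⟨fun s => l (g s), fun s => ?_, fun s => h2 _, fun s s' hss x hx hx' => ?_⟩
  · simpa only [hg] using h1 (g s)
  · refine hd (g s) (g s') (fun h => hss (by rw [← hg s, ← hg s', h])) x (h3 _ x ?_) (h3 _ x ?_)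
    · simpa only [hg] using hx
    · simpa only [hg] using hx'

theorem linkage_from [Fintype V] {E : Finset (V × V)} {C : Set V} (P : Finset V) {k : ℕ}
    (hk : P.card = k) (p : Fin k → List V) (hp : ∀ i, IsDW E P C (p i))
    (hd : ∀ i j, i ≠ j → ∀ x ∈ p i, x ∉ p j) :
    ∃ l : P → List V, (∀ s, IsDW E P C (s.1 :: l s)) ∧ (∀ s, ∀ x ∈ l s, x ∉ P) ∧
      ∀ s s', s ≠ s' → ∀ x ∈ s.1 :: l s, x ∉ s'.1 :: l s' := by
  have h : ∀ i, ∃ (l1 : List V) (b : P), IsDW E P C (b.1 :: l1) ∧ (∀ x ∈ l1, x ∉ P) ∧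
      ∀ x ∈ b.1 :: l1, x ∈ p i := by
    intro i
    obtain ⟨l1, b, l2, h1, h2, h3⟩ := last_hit (P : Set V) (p i) (by
      obtain ⟨-, ⟨c, hc, hcC⟩, -⟩ := hp i
      exact ⟨c, List.mem_of_head? hc, hcC⟩)
    refine ⟨l2, ⟨b, h2⟩, ?_, by simpa using h3, ?_⟩
    · exact isDW_suffix (h1 ▸ hp i) h2
    · rw [h1]; intro x hx; simp at hx ⊢; tauto
  choose l b h1 h2 h3 using h
  have hinj : Function.Injective b := by
    intro i j hij
    by_contra hne
    exact hd i j hne (b i).1 (h3 i _ (by simp)) (h3 j _ (by simp [hij]))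
  have hsurj : Function.Surjective b :=
    ((Fintype.bijective_iff_injective_and_card b).2 ⟨hinj, by simp [hk]⟩).2
  choose g hg using hsurj
  refine ⟨fun s => l (g s), fun s => ?_, fun s => h2 _, fun s s' hss x hx hx' => ?_⟩
  · simpa only [hg] using h1 (g s)
  · refine hd (g s) (g s') (fun h => hss (by rw [← hg s, ← hg s', h])) x (h3 _ x ?_) (h3 _ x ?_)
    · simpa only [hg] using hx
    · simpa only [hg] using hx'

theorem menger [Fintype V] [DecidableEq V] (E : Finset (V × V)) : ∀ (k : ℕ) (A C : Set V),
    (∀ S : Finset V, (∀ l, IsDW E A C l → ∃ x ∈ l, x ∈ S) → k ≤ S.card) →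
    ∃ p : Fin k → List V, (∀ i, IsDW E A C (p i)) ∧ ∀ i j, i ≠ j → ∀ x ∈ p i, x ∉ p j := by
  classical
  induction E using Finset.induction_on with
  | empty =>
    intro k A C h
    have hk := h (Finset.univ.filter fun x => x ∈ A ∧ x ∈ C) (by
      rintro l ⟨h1, ⟨a, ha, haA⟩, c, hc, hcC⟩
      match l, h1 with
      | [], _ => simp at ha
      | [z], _ =>
        simp at ha hc
        subst ha; subst hc
        exact ⟨z, by simp, by simp [haA, hcC]⟩
      | z :: y :: l, h1 => simp at h1)
    obtain ⟨T, hT, hTk⟩ := Finset.exists_subset_card_eq hk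
    let e := (T.equivFinOfCardEq hTk).symm
    refine ⟨fun i => [(e i).1], fun i => ?_, fun i j hij x hx hx' => ?_⟩
    · have := hT (e i).2
      simp only [Finset.mem_filter] at this
      exact ⟨by simp, ⟨_, by simp, this.2.1⟩, _, by simp, this.2.2⟩
    · simp only [List.mem_singleton] at hx hx'
      exact hij (e.injective (Subtype.ext (hx ▸ hx')))
  | insert e E he ih =>
    intro k A C h
    obtain ⟨x, y⟩ := e
    by_cases hS : ∀ S : Finset V, (∀ l, IsDW E A C l → ∃ x ∈ l, x ∈ S) → k ≤ S.card
    · obtain ⟨p, h1, h2⟩ := ih k A C hS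
      exact ⟨p, fun i => isDW_mono (Finset.subset_insert _ _) (h1 i), h2⟩
    push Not at hS
    obtain ⟨S, hSsep, hSk⟩ := hS
    -- a walk using neither `x` as a source nor `y` as a target is a walk of `E`
    have hPsep : ∀ l, IsDW (insert (x, y) E) A C l → ∃ z ∈ l, z ∈ insert x S := by
      intro l hl
      by_cases hx : x ∈ l
      · exact ⟨x, hx, by simp⟩
      · obtain ⟨z, hz, hzS⟩ := hSsep l ⟨hl.1.imp_of_mem_imp (fun a b ha hb hab => by
          rcases Finset.mem_insert.1 hab with h | h
          · cases h; exact absurd ha hx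
          · exact h), hl.2⟩
        exact ⟨z, hz, by simp [hzS]⟩
    have hQsep : ∀ l, IsDW (insert (x, y) E) A C l → ∃ z ∈ l, z ∈ insert y S := by
      intro l hl
      by_cases hx : y ∈ l
      · exact ⟨y, hx, by simp⟩
      · obtain ⟨z, hz, hzS⟩ := hSsep l ⟨hl.1.imp_of_mem_imp (fun a b ha hb hab => by
          rcases Finset.mem_insert.1 hab with h | h
          · cases h; exact absurd hb hx
          · exact h), hl.2⟩
        exact ⟨z, hz, by simp [hzS]⟩
    have hPk := h _ hPsep
    have hQk := h _ hQsep
    have hxS : x ∉ S := fun hx => by rw [Finset.insert_eq_of_mem hx] at hPk; omega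
    have hyS : y ∉ S := fun hx => by rw [Finset.insert_eq_of_mem hx] at hQk; omega
    have hPc : (insert x S).card = k := by
      rw [Finset.card_insert_of_notMem hxS] at hPk ⊢; omega
    have hQc : (insert y S).card = k := by
      rw [Finset.card_insert_of_notMem hyS] at hQk ⊢; omega
    obtain ⟨p, hp1, hp2⟩ := ih k A (insert x S : Finset V) (by
      intro T hT
      refine h T fun l hl => ?_
      obtain ⟨l1, b, l2, rfl, hb, hl1⟩ := first_hit (insert x S : Finset V) l (hPsep l hl)
      obtain ⟨q1, q2, q3⟩ := isDW_prefix hl hb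
      suffices hch : (l1 ++ [b]).IsChain (fun a b => (a, b) ∈ E) by
        obtain ⟨z, hz, hzT⟩ := hT (l1 ++ [b]) ⟨hch, q2, q3⟩
        exact ⟨z, by simp at hz ⊢; tauto, hzT⟩
      · have hx1 : x ∉ l1 := fun hx => hl1 x hx (by simp)
        clear hl q2 q3 hl1
        induction l1 with
        | nil => simp
        | cons a l1 ih2 =>
          cases l1 with
          | nil =>
            simp at q1 hx1 ⊢
            rcases q1 with q | q
            · exact absurd q.1.symm hx1
            · exact q
          | cons a' l1 =>
            simp only [List.cons_append, List.isChain_cons_cons] at q1 ih2 ⊢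
            refine ⟨?_, ih2 q1.2 (by simp at hx1 ⊢; tauto)⟩
            have := q1.1
            simp at this hx1
            tauto)
    obtain ⟨q, hq1, hq2⟩ := ih k (insert y S : Finset V) C (by
      intro T hT
      refine h T fun l hl => ?_
      obtain ⟨l1, b, l2, rfl, hb, hl1⟩ := last_hit (insert y S : Finset V) l (hQsep l hl)
      obtain ⟨q1, q2, q3⟩ := isDW_suffix hl hb
      suffices hch : (b :: l2).IsChain (fun a b => (a, b) ∈ E) by
        obtain ⟨z, hz, hzT⟩ := hT (b :: l2) ⟨hch, q2, q3⟩
        exact ⟨z, by simp at hz ⊢; tauto, hzT⟩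
      · have hx1 : y ∉ l2 := fun hx => hl1 y hx (by simp)
        refine q1.imp_of_mem_tail_imp fun a c _ hc hac => ?_
        rcases Finset.mem_insert.1 hac with h | h
        · cases h; exact absurd hc hx1
        · exact h)
    obtain ⟨l, l1, l2, l3⟩ := linkage_to _ hPc p hp1 hp2
    obtain ⟨m, m1, m2, m3⟩ := linkage_from _ hQc q hq1 hq2
    have cross : ∀ s s' z, z ∈ l s ++ [s.1] → z ∈ s'.1 :: m s' → z = s.1 ∧ z = s'.1 ∧ z ∈ S := by
      intro s s' z hz hz'
      have hzS : z ∈ S := by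
        by_contra hzS
        obtain ⟨u1, u2, hu⟩ := List.append_of_mem hz
        obtain ⟨w1, w2, hw⟩ := List.append_of_mem hz'
        have d1 := l1 s
        rw [hu] at d1
        have d2 := m1 s'
        rw [hw] at d2
        have d := isDW_glue (isDW_prefix (P := Set.univ) d1 trivial)
          (isDW_suffix (P := Set.univ) d2 trivial)
        obtain ⟨c, hc, hcS⟩ := hSsep _ d
        simp only [List.mem_append, List.mem_cons] at hc
        rcases hc with hc | rfl | hc
        · have : c ∈ l s := by
            rw [List.append_eq_append_iff] at hu
            rcases hu with ⟨a', h1, h2⟩ | ⟨a', h1, h2⟩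
            · cases a' with
              | nil => simp at h1; rwa [← h1]
              | cons _ _ => simp at h2
            · rw [h1]; simp [hc]
          exact l2 s c this (by simp [hcS])
        · exact hzS hcS
        · have : c ∈ m s' := by
            cases w1 with
            | nil => simp at hw; rw [hw.2]; exact hc
            | cons _ _ => simp at hw; rw [hw.2]; simp [hc]
          exact m2 s' c this (by simp [hcS])
      refine ⟨?_, ?_, hzS⟩
      · simp only [List.mem_append, List.mem_singleton] at hz
        exact hz.resolve_left fun h => l2 s z h (by simp [hzS])
      · simp only [List.mem_cons] at hz'
        exact hz'.resolve_right fun h => m2 s' z h (by simp [hzS])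
    have comb : ∀ s : (insert x S : Finset V), ∃ (f : (insert y S : Finset V)) (r : List V),
        (f.1 ∈ S → f.1 = s.1) ∧ (f.1 ∉ S → s.1 = x) ∧ IsDW (insert (x, y) E) A C r ∧
        ∀ z ∈ r, z ∈ l s ++ [s.1] ∨ z ∈ f.1 :: m f := by
      intro s
      have d1 := isDW_mono (Finset.subset_insert (x, y) E) (l1 s)
      by_cases hs : s.1 = x
      · have d2 := isDW_mono (Finset.subset_insert (x, y) E) (m1 ⟨y, by simp⟩)
        refine ⟨⟨y, by simp⟩, _, fun h => absurd h hyS, fun _ => hs,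
          isDW_glue_edge d1 d2 (by simp [hs]), ?_⟩
        intro z hz; simp at hz ⊢; tauto
      · have hsS : s.1 ∈ S := (Finset.mem_insert.1 s.2).resolve_left hs
        have d2 := isDW_mono (Finset.subset_insert (x, y) E) (m1 ⟨s.1, by simp [hsS]⟩)
        refine ⟨⟨s.1, by simp [hsS]⟩, _, fun h => rfl, fun h => absurd hsS h, isDW_glue d1 d2, ?_⟩
        intro z hz; simp at hz ⊢; tauto
    choose f r f1 f2 r1 r2 using comb
    have finj : ∀ s s', s ≠ s' → f s ≠ f s' := by
      intro s s' hss hf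
      apply hss
      apply Subtype.ext
      by_cases hm : (f s).1 ∈ S
      · rw [← f1 s hm, hf, f1 s' (hf ▸ hm)]
      · rw [f2 s hm, f2 s' (hf ▸ hm)]
    let g := ((insert x S).equivFinOfCardEq hPc).symm
    refine ⟨fun i => r (g i), fun i => r1 _, fun i j hij z hz hz' => ?_⟩
    have hg : g i ≠ g j := fun h => hij (g.injective h)
    rcases r2 _ z hz with h1 | h1 <;> rcases r2 _ z hz' with h2 | h2
    · exact l3 _ _ hg z h1 h2
    · obtain ⟨c1, c2, c3⟩ := cross _ _ z h1 h2
      exact hg (Subtype.ext (by rw [← c1, ← f1 (g j) (c2 ▸ c3), ← c2]))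
    · obtain ⟨c1, c2, c3⟩ := cross _ _ z h2 h1
      exact hg (Subtype.ext (by rw [← c1, ← f1 (g i) (c2 ▸ c3), ← c2]))
    · exact m3 _ _ (finj _ _ hg) z h1 h2

/-- From a bramble of order at least `2t+1` one obtains two disjoint paths each
restricting the bramble to order exactly `t`, linked by `t` disjoint paths. -/
theorem stmt_6 [Fintype V] (G : SimpleGraph V) (B : Set (Set V)) (t : ℕ) (ht : 0 < t)
    (hB : IsBramble G B) (hord : 2 * t + 1 ≤ brambleOrder B) :
    ∃ (a₁ b₁ a₂ b₂ : V) (P₁ : G.Walk a₁ b₁) (P₂ : G.Walk a₂ b₂),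
      P₁.IsPath ∧ P₂.IsPath ∧
      (∀ x ∈ P₁.support, x ∉ P₂.support) ∧
      brambleOrder (sub B {x | x ∈ P₁.support}) = t ∧
      brambleOrder (sub B {x | x ∈ P₂.support}) = t ∧
      ∃ (u v : Fin t → V) (Q : ∀ i, G.Walk (u i) (v i)),
        (∀ i, (Q i).IsPath) ∧
        (∀ i, u i ∈ P₁.support) ∧ (∀ i, v i ∈ P₂.support) ∧
        (∀ i, ∀ x ∈ (Q i).support, x ≠ u i → x ≠ v i →
          x ∉ P₁.support ∧ x ∉ P₂.support) ∧
        (∀ i j, i ≠ j → ∀ x ∈ (Q i).support, x ∉ (Q j).support) := by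
  classical
  have hne : ∀ S ∈ B, S.Nonempty := fun S hS => (hB.1 S hS).1
  have hBne : B.Nonempty := by
    rw [Set.nonempty_iff_ne_empty]
    rintro rfl
    have : brambleOrder (∅ : Set (Set V)) ≤ (∅ : Set V).ncard := order_le fun S hS => hS.elim
    simp at this
    omega
  obtain ⟨a, b, P, hP, hhit⟩ := hitting_path hB hBne
  have hsubB : sub B {x | x ∈ P.support} = B := by
    ext S
    exact ⟨fun h => h.1, fun h => ⟨h, hhit S h⟩⟩
  obtain ⟨n, hn⟩ := exists_take hne t P.support (by rw [hsubB]; omega)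
  obtain ⟨m, hm⟩ := exists_take hne t (P.support.drop n) (by
    have := order_sub_union hne {x | x ∈ P.support.take n} {x | x ∈ P.support.drop n}
      {x | x ∈ P.support} (by
        intro z hz
        have hz' : z ∈ P.support := hz
        rw [← List.take_append_drop n P.support, List.mem_append] at hz'
        exact hz')
    rw [hsubB] at this
    omega)
  have hchain := P.isChain_adj_support
  have hnodup := hP.support_nodup
  rw [← List.take_append_drop n P.support] at hchain hnodup
  generalize P.support.take n = L1 at *
  generalize P.support.drop n = L2 at *
  rw [← List.take_append_drop m L2] at hchain hnodup
  generalize L2.take m = L3 at *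
  generalize L2.drop m = L4 at *
  have c1 : L1.IsChain G.Adj := (List.isChain_append.1 hchain).1
  have c2 : L3.IsChain G.Adj := (List.isChain_append.1 (List.isChain_append.1 hchain).2.1).1
  have e1 : L1 ≠ [] := by
    rintro rfl
    simp [order_sub_empty] at hn
    omega
  have e2 : L3 ≠ [] := by
    rintro rfl
    simp [order_sub_empty] at hm
    omega
  rw [List.nodup_append, List.nodup_append] at hnodup
  -- separators are large
  let E : Finset (V × V) := Finset.univ.filter fun e => G.Adj e.1 e.2
  obtain ⟨p, hp, hpd⟩ := menger E t {x | x ∈ L1} {x | x ∈ L3} (by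
    intro X hX
    by_contra hlt
    have get : ∀ L : List V, brambleOrder (sub B {x | x ∈ L}) = t →
        ∃ S ∈ B, (∃ s ∈ S, s ∈ L) ∧ ∀ z ∈ S, z ∉ X := by
      intro L hL
      by_contra hcon
      have : brambleOrder (sub B {x | x ∈ L}) ≤ (X : Set V).ncard := order_le (by
        rintro S ⟨hS, s, hs, hsL⟩
        by_contra hSX
        exact hcon ⟨S, hS, ⟨s, hs, hsL⟩, fun z hz hzX => hSX ⟨z, hz, hzX⟩⟩)
      rw [Set.ncard_coe_finset] at this
      omega
    obtain ⟨S, hS, ⟨s, hs, hsL⟩, hSX⟩ := get L1 hn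
    obtain ⟨T, hT, ⟨s', hs', hsL'⟩, hTX⟩ := get L3 hm
    obtain ⟨w, hw⟩ := walk_touch hB hS hT hs hs'
    obtain ⟨z, hz, hzX⟩ := hX w.support ⟨w.isChain_adj_support.imp fun a b h => by simp [E, h],
      ⟨s, by simp [List.head?_eq_some_head], hsL⟩,
      ⟨s', by simp [List.getLast?_eq_some_getLast], hsL'⟩⟩
    rcases hw z hz with h | h
    · exact hSX z h hzX
    · exact hTX z h hzX)
  have hq : ∀ i, ∃ (u v : V) (q : G.Walk u v), q.IsPath ∧ u ∈ L1 ∧ v ∈ L3 ∧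
      (∀ z ∈ q.support, z ∈ p i) ∧ ∀ x ∈ q.support, x ≠ u → x ≠ v → x ∉ L1 ∧ x ∉ L3 := by
    intro i
    obtain ⟨h1, ⟨a, ha, haA⟩, c, hc, hcC⟩ := hp i
    have hpne : p i ≠ [] := by
      intro h
      simp [h] at ha
    have h1' : (p i).IsChain G.Adj := h1.imp fun a b h => by simpa [E] using h
    exact normal_walk {x | x ∈ L1} {x | x ∈ L3} {x | x ∈ p i} (Walk.ofSupport (p i) hpne h1')
      (by rw [List.head?_eq_some_head hpne] at ha; cases ha; exact haA)
      (by rw [List.getLast?_eq_some_getLast hpne] at hc; cases hc; exact hcC)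
      (by rw [Walk.support_ofSupport]; exact fun z hz => hz)
  choose u v q q1 q2 q3 q4 q5 using hq
  refine ⟨_, _, _, _, Walk.ofSupport L1 e1 c1, Walk.ofSupport L3 e2 c2, ?_⟩
  simp only [Walk.isPath_def, Walk.support_ofSupport]
  refine ⟨hnodup.1, hnodup.2.1.1, ?_, hn, hm, u, v, q, ?_, q2, q3, q5, ?_⟩
  · intro x hx hx'
    exact hnodup.2.2 x hx x (by simp [hx']) rfl
  · intro i
    exact (Walk.isPath_def _).1 (q1 i)
  · intro i j hij x hx hx'
    exact hpd i j hij x (q4 i x hx) (q4 j x hx')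
end
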